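/- arXiv:1506.05517 — 2 statements merged into one kernel-verified Lean document; each statement's English description precedes it below -/
import Mathlib

section
/- Let n ≥ 5 and let φ be an automorphism of B'_n such that μ'∘φ = μ'. Then φ maps J_n onto J_n, and the induced automorphism φ_* of the abelianization J_n^{ab} is either the identity or inversion; that is, either φ(x)·x^{−1} ∈ [J_n, J_n] for every x ∈ J_n, or φ(x)·x ∈ [J_n, J_n] for every x ∈ J_n. -/
/-- Relators of the Artin presentation of the braid group on `n` strings:
generators `σ_0, …, σ_{n-2}` (0-based), with `σ_i σ_j = σ_j σ_i` for `|i-j| > 1`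
and `σ_i σ_j σ_i = σ_j σ_i σ_j` for `|i-j| = 1`. -/
def braidRels (n : ℕ) : Set (FreeGroup (Fin (n - 1))) :=
  {r | (∃ i j : Fin (n - 1), (i : ℕ) + 2 ≤ (j : ℕ) ∧
          r = FreeGroup.of i * FreeGroup.of j * (FreeGroup.of i)⁻¹ * (FreeGroup.of j)⁻¹) ∨
       (∃ i j : Fin (n - 1), (j : ℕ) = (i : ℕ) + 1 ∧
          r = FreeGroup.of i * FreeGroup.of j * FreeGroup.of i *
              (FreeGroup.of j * FreeGroup.of i * FreeGroup.of j)⁻¹)}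

/-- The braid group `B_n`, presented by Artin generators and relations. -/
abbrev BraidGroup (n : ℕ) := PresentedGroup (braidRels n)

/-- The Artin generator `σ_{i+1}` (1-based), i.e. `σ i` for `i : Fin (n-1)` (0-based). -/
def σ {n : ℕ} (i : Fin (n - 1)) : BraidGroup n := PresentedGroup.of i

/-- `J_n = B'_n ∩ P_n`, viewed as a subgroup of `B'_n` (the elements of the commutator
subgroup lying in the kernel of `μ : B_n → S_n`). -/
def Jsub (n : ℕ) (μ : BraidGroup n →* Equiv.Perm (Fin n)) :
    Subgroup ↥(commutator (BraidGroup n)) :=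
  Subgroup.comap (commutator (BraidGroup n)).subtype μ.ker

/-- The Artin generator with a natural-number index, extended by `1` out of range. -/
def artin (n k : ℕ) : BraidGroup n := if h : k < n - 1 then σ ⟨k, h⟩ else 1

lemma artin_of_lt {n k : ℕ} (h : k < n - 1) : artin n k = σ ⟨k, h⟩ := dif_pos h

lemma artin_commute {n i j : ℕ} (h : i + 2 ≤ j) : Commute (artin n i) (artin n j) := by
  by_cases hj : j < n - 1
  · have hi : i < n - 1 := by omega
    rw [artin_of_lt hi, artin_of_lt hj]
    have := PresentedGroup.mk_eq_mk_of_mul_inv_mem (rels := braidRels n)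
      (x := FreeGroup.of ⟨i, hi⟩ * FreeGroup.of ⟨j, hj⟩)
      (y := FreeGroup.of ⟨j, hj⟩ * FreeGroup.of ⟨i, hi⟩)
      (Or.inl ⟨⟨i, hi⟩, ⟨j, hj⟩, h, by group⟩)
    simp only [map_mul] at this
    exact this
  · rw [artin, artin, dif_neg hj]
    exact Commute.one_right _

lemma artin_braid {n i : ℕ} (h : i + 1 < n - 1) :
    artin n i * artin n (i + 1) * artin n i = artin n (i + 1) * artin n i * artin n (i + 1) := by
  have hi : i < n - 1 := by omega
  rw [artin_of_lt hi, artin_of_lt h]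
  have := PresentedGroup.mk_eq_mk_of_mul_inv_mem (rels := braidRels n)
    (x := FreeGroup.of ⟨i, hi⟩ * FreeGroup.of ⟨i + 1, h⟩ * FreeGroup.of ⟨i, hi⟩)
    (y := FreeGroup.of ⟨i + 1, h⟩ * FreeGroup.of ⟨i, hi⟩ * FreeGroup.of ⟨i + 1, h⟩)
    (Or.inr ⟨⟨i, hi⟩, ⟨i + 1, h⟩, rfl, rfl⟩)
  simp only [map_mul] at this
  exact this

lemma closure_artin (n : ℕ) :
    Subgroup.closure {g : BraidGroup n | ∃ i < n - 1, g = artin n i} = ⊤ := by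
  rw [eq_top_iff, ← PresentedGroup.closure_range_of, Subgroup.closure_le]
  rintro _ ⟨i, rfl⟩
  exact Subgroup.subset_closure ⟨i, i.isLt, (artin_of_lt i.isLt).symm⟩

lemma artin_induction {n : ℕ} (H : Subgroup (BraidGroup n)) (h : ∀ i < n - 1, artin n i ∈ H)
    (g : BraidGroup n) : g ∈ H := by
  have : (⊤ : Subgroup (BraidGroup n)) ≤ H := by
    rw [← closure_artin, Subgroup.closure_le]
    rintro _ ⟨i, hi, rfl⟩
    exact h i hi
  exact this trivial

section Coxeter

variable {Q : Type*} [Group Q]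

/-- The descending product `s m * s (m - 1) * ⋯` of `j` factors. -/
def descProd (s : ℕ → Q) (m : ℕ) : ℕ → Q
  | 0 => 1
  | j + 1 => descProd s m j * s (m - j)

lemma descProd_commute {s : ℕ → Q} (hc : ∀ i j, i + 2 ≤ j → Commute (s i) (s j)) {m i j : ℕ}
    (h : i + j < m) : Commute (s i) (descProd s m j) := by
  induction j with
  | zero => exact Commute.one_right _
  | succ j ih => exact (ih (by omega)).mul_right (hc _ _ (by omega))

lemma descProd_mul_shift {s : ℕ → Q} (hc : ∀ i j, i + 2 ≤ j → Commute (s i) (s j)) {m i j : ℕ}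
    (hb : ∀ i < m, s i * s (i + 1) * s i = s (i + 1) * s i * s (i + 1))
    (hi : i + 1 ≤ m) (hj : j ≤ m + 1) (h : m + 1 < i + 1 + j) :
    descProd s m j * s (i + 1) = s i * descProd s m j := by
  induction j with
  | zero => omega
  | succ j ih =>
    rcases Nat.lt_or_ge (m + 1) (i + 1 + j) with h' | h'
    · have hcm := hc (m - j) (i + 1) (by omega)
      rw [descProd, mul_assoc, hcm.eq, ← mul_assoc, ih (by omega) h', mul_assoc]
    · obtain ⟨k, rfl⟩ : ∃ k, j = k + 1 := ⟨j - 1, by omega⟩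
      have h1 : m - (k + 1) = i := by omega
      have h2 : m - k = i + 1 := by omega
      have h3 := descProd_commute hc (m := m) (i := i) (j := k) (by omega)
      rw [descProd, descProd, h1, h2]
      calc _ = descProd s m k * (s (i + 1) * s i * s (i + 1)) := by group
        _ = descProd s m k * s i * (s (i + 1) * s i) := by
          rw [← hb i (by omega)]; group
        _ = _ := by rw [← h3.eq]; group

/-- Coset decomposition for a group generated by involutions satisfying the braid relations. -/
lemma exists_eq_mul_descProd {s : ℕ → Q} (hc : ∀ i j, i + 2 ≤ j → Commute (s i) (s j)) {m : ℕ}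
    (hb : ∀ i < m, s i * s (i + 1) * s i = s (i + 1) * s i * s (i + 1))
    (hs : ∀ i ≤ m, s i * s i = 1) {g : Q}
    (hg : g ∈ Subgroup.closure {x | ∃ i < m + 1, x = s i}) :
    ∃ h ∈ Subgroup.closure {x | ∃ i < m, x = s i}, ∃ j ≤ m + 1, g = h * descProd s m j := by
  have key : ∀ i ≤ m, ∀ g : Q,
      (∃ h ∈ Subgroup.closure {x | ∃ i < m, x = s i}, ∃ j ≤ m + 1, g = h * descProd s m j) →
      ∃ h ∈ Subgroup.closure {x | ∃ i < m, x = s i}, ∃ j ≤ m + 1,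
        g * s i = h * descProd s m j := by
    rintro i hi _ ⟨h, hh, j, hj, rfl⟩
    rcases Nat.lt_trichotomy (i + j) m with hlt | heq | hgt
    · refine ⟨h * s i, mul_mem hh (Subgroup.subset_closure ⟨i, by omega, rfl⟩), j, hj, ?_⟩
      rw [mul_assoc, mul_assoc, (descProd_commute hc hlt).eq]
    · refine ⟨h, hh, j + 1, by omega, ?_⟩
      rw [descProd, show m - j = i by omega, mul_assoc]
    · rcases Nat.lt_or_ge (m + 1) (i + j) with h1 | h1
      · obtain ⟨i, rfl⟩ : ∃ k, i = k + 1 := ⟨i - 1, by omega⟩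
        refine ⟨h * s i, mul_mem hh (Subgroup.subset_closure ⟨i, by omega, rfl⟩), j, hj, ?_⟩
        rw [mul_assoc, mul_assoc, descProd_mul_shift hc hb hi hj h1]
      · obtain ⟨j, rfl⟩ : ∃ k, j = k + 1 := ⟨j - 1, by omega⟩
        refine ⟨h, hh, j, by omega, ?_⟩
        rw [descProd, show m - j = i by omega, mul_assoc, mul_assoc, hs i hi, mul_one]
  induction hg using Subgroup.closure_induction_right with
  | one => exact ⟨1, one_mem _, 0, by omega, by simp [descProd]⟩
  | mul_right x _ y hy ih =>
    obtain ⟨i, hi, rfl⟩ := hy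
    exact key i (by omega) x ih
  | mul_inv_cancel x _ y hy ih =>
    obtain ⟨i, hi, rfl⟩ := hy
    rw [inv_eq_of_mul_eq_one_right (hs i (by omega))]
    exact key i (by omega) x ih

lemma descProd_apply {n : ℕ} {s : ℕ → Q} {f : Q →* Equiv.Perm (Fin n)}
    (hf : ∀ i (h : i + 1 < n), f (s i) = Equiv.swap ⟨i, by omega⟩ ⟨i + 1, h⟩) {m j : ℕ}
    (hm : m + 1 < n) (hj : j ≤ m + 1) :
    f (descProd s m j) ⟨m + 1 - j, by omega⟩ = ⟨m + 1, hm⟩ := by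
  induction j with
  | zero => simp [descProd]
  | succ j ih =>
    rw [descProd, map_mul, Equiv.Perm.mul_apply, hf (m - j) (by omega)]
    have : (⟨m + 1 - (j + 1), by omega⟩ : Fin n) = ⟨m - j, by omega⟩ := by
      ext; simp
    rw [this, Equiv.swap_apply_left, ← ih (by omega)]
    congr 2
    omega

/-- The symmetric group has the Coxeter presentation of type `A`. -/
lemma eq_one_of_map_perm_eq_one {n : ℕ} {s : ℕ → Q} {f : Q →* Equiv.Perm (Fin n)}
    (hc : ∀ i j, i + 2 ≤ j → Commute (s i) (s j))
    (hb : ∀ i, i + 1 < n - 1 → s i * s (i + 1) * s i = s (i + 1) * s i * s (i + 1))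
    (hs : ∀ i < n - 1, s i * s i = 1)
    (hf : ∀ i (h : i + 1 < n), f (s i) = Equiv.swap ⟨i, by omega⟩ ⟨i + 1, h⟩)
    {m : ℕ} (hm : m ≤ n - 1) {g : Q} (hg : g ∈ Subgroup.closure {x | ∃ i < m, x = s i})
    (hfg : f g = 1) : g = 1 := by
  induction m generalizing g with
  | zero => simpa using hg
  | succ m ih =>
    obtain ⟨h, hh, j, hj, rfl⟩ := exists_eq_mul_descProd hc (fun i hi => hb i (by omega))
      (fun i hi => hs i (by omega)) hg
    have hfix : f h ⟨m + 1, by omega⟩ = ⟨m + 1, by omega⟩ := by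
      have : Subgroup.closure {x | ∃ i < m, x = s i} ≤
          (MulAction.stabilizer (Equiv.Perm (Fin n)) (⟨m + 1, by omega⟩ : Fin n)).comap f := by
        rw [Subgroup.closure_le]
        rintro _ ⟨i, hi, rfl⟩
        simp only [Subgroup.coe_comap, Set.mem_preimage, SetLike.mem_coe,
          MulAction.mem_stabilizer_iff, Equiv.Perm.smul_def]
        rw [hf i (by omega)]
        exact Equiv.swap_apply_of_ne_of_ne (by simp; omega) (by simp; omega)
      exact this hh
    have h1 := descProd_apply hf (m := m) (j := j) (by omega) hj
    have h2 := congrArg (fun e => e (⟨m + 1 - j, by omega⟩ : Fin n)) hfg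
    simp only [map_mul, Equiv.Perm.mul_apply, h1, hfix, Equiv.Perm.one_apply, Fin.mk.injEq] at h2
    obtain rfl : j = 0 := by omega
    simp only [descProd, mul_one] at hfg hh ⊢
    exact ih (by omega) hh hfg

end Coxeter

lemma artin_conj_succ {n i : ℕ} (h : i + 1 < n - 1) :
    (artin n i * artin n (i + 1)) * artin n i * (artin n i * artin n (i + 1))⁻¹ =
      artin n (i + 1) := by
  rw [artin_braid h]
  group

lemma map_artin_eq_of_comm {n : ℕ} {A : Type*} [CommGroup A] (f : BraidGroup n →* A) {i : ℕ}
    (h : i < n - 1) : f (artin n i) = f (artin n 0) := by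
  induction i with
  | zero => rfl
  | succ i ih =>
    rw [← ih (by omega), ← artin_conj_succ h, map_mul, map_mul, map_inv, mul_right_comm,
      mul_inv_cancel, one_mul]

/-- The exponent-sum homomorphism. -/
def braidDegree (n : ℕ) : BraidGroup n →* Multiplicative ℤ :=
  PresentedGroup.toGroup (f := fun _ => Multiplicative.ofAdd 1) <| by
    rintro _ (⟨i, j, -, rfl⟩ | ⟨i, j, -, rfl⟩) <;> simp

lemma braidDegree_artin {n i : ℕ} (h : i < n - 1) :
    braidDegree n (artin n i) = Multiplicative.ofAdd 1 := by
  rw [artin_of_lt h]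
  exact PresentedGroup.toGroup.of _

lemma commutator_le_ker {G A : Type*} [Group G] [CommGroup A] (f : G →* A) :
    commutator G ≤ f.ker :=
  Abelianization.commutator_subset_ker f

lemma mem_commutator_iff_abelianization {G : Type*} [Group G] {g : G} :
    g ∈ commutator G ↔ Abelianization.of g = 1 := by
  rw [← MonoidHom.mem_ker, Abelianization.ker_of]

lemma exists_mul_zpow_mem_commutator {n k : ℕ} (hk : k < n - 1) (g : BraidGroup n) :
    ∃ d : ℤ, g * artin n k ^ d ∈ commutator (BraidGroup n) := by
  let H : Subgroup (BraidGroup n) :=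
    (Subgroup.zpowers (Abelianization.of (artin n k))).comap Abelianization.of
  have : g ∈ H := artin_induction H (fun i hi => by
    simp only [H, Subgroup.mem_comap]
    rw [map_artin_eq_of_comm _ hi, ← map_artin_eq_of_comm _ hk]
    exact Subgroup.mem_zpowers _) g
  obtain ⟨d, hd⟩ := Subgroup.mem_zpowers_iff.mp this
  refine ⟨-d, ?_⟩
  rw [mem_commutator_iff_abelianization, map_mul, map_zpow, ← hd]
  group

section Pure

variable {n : ℕ} {μ : BraidGroup n →* Equiv.Perm (Fin n)}

/-- `μ` sends the Artin generators to the adjacent transpositions. -/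
def IsStandardPerm (μ : BraidGroup n →* Equiv.Perm (Fin n)) : Prop :=
  ∀ i (h : i + 1 < n), μ (artin n i) = Equiv.swap ⟨i, by omega⟩ ⟨i + 1, h⟩

lemma IsStandardPerm.artin_sq_mem_ker (hμ : IsStandardPerm μ) {i : ℕ} (h : i < n - 1) :
    artin n i ^ 2 ∈ μ.ker := by
  rw [MonoidHom.mem_ker, map_pow, hμ i (by omega), sq, Equiv.swap_mul_self]

lemma IsStandardPerm.exists_sq (hμ : IsStandardPerm μ) {k : ℕ} (hk : k < n - 1)
    {g : BraidGroup n} (hg : Equiv.Perm.sign (μ g) = 1) :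
    ∃ d : ℤ, g * (artin n k ^ 2) ^ d ∈ commutator (BraidGroup n) := by
  obtain ⟨d, hd⟩ := exists_mul_zpow_mem_commutator hk g
  have h1 : Equiv.Perm.sign (μ (g * artin n k ^ d)) = 1 :=
    (MonoidHom.mem_ker (f := Equiv.Perm.sign.comp μ)).mp (commutator_le_ker _ hd)
  rw [map_mul, map_mul, hg, one_mul, map_zpow, map_zpow, hμ k (by omega),
    Equiv.Perm.sign_swap (by simp)] at h1
  have h2 : Even d := by
    by_contra hodd
    rw [Int.not_even_iff_odd] at hodd
    rw [hodd.neg_one_zpow] at h1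
    exact absurd h1 (by decide)
  obtain ⟨e, rfl⟩ := h2
  refine ⟨e, ?_⟩
  rwa [← zpow_natCast, ← zpow_mul, show ((2 : ℕ) : ℤ) * e = e + e by push_cast; ring]

lemma artin_sq_mem {n : ℕ} {M : Subgroup (BraidGroup n)} [M.Normal] (h0 : artin n 0 ^ 2 ∈ M)
    {i : ℕ} (h : i < n - 1) : artin n i ^ 2 ∈ M := by
  induction i with
  | zero => exact h0
  | succ i ih =>
    rw [← artin_conj_succ h, conj_pow]
    exact Subgroup.Normal.conj_mem ‹_› _ (ih (by omega)) _

/-- The pure braid group is the normal closure of the square of a generator. -/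
lemma IsStandardPerm.ker_le_normalClosure (hμ : IsStandardPerm μ) (hn : 2 ≤ n) :
    μ.ker ≤ Subgroup.normalClosure {artin n 0 ^ 2} := by
  set M := Subgroup.normalClosure {artin n 0 ^ 2} with hM
  have h0 : artin n 0 ^ 2 ∈ M := Subgroup.subset_normalClosure rfl
  have hle : M ≤ μ.ker := Subgroup.normalClosure_le_normal (by
    rintro _ rfl
    exact hμ.artin_sq_mem_ker (by omega))
  let q := QuotientGroup.mk' M
  let f : BraidGroup n ⧸ M →* Equiv.Perm (Fin n) := QuotientGroup.lift M μ hle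
  intro g hg
  have : q g = 1 := by
    refine eq_one_of_map_perm_eq_one (s := fun i => q (artin n i)) (f := f) (m := n - 1)
      (fun i j h => (artin_commute h).map q) (fun i h => ?_) (fun i h => ?_) (fun i h => hμ i h)
      le_rfl ?_ hg
    · simp only [← map_mul, artin_braid h]
    · rw [← map_mul, ← sq]
      exact (QuotientGroup.eq_one_iff _).mpr (artin_sq_mem h0 h)
    · have := Subgroup.mem_map_of_mem q (show g ∈ (⊤ : Subgroup _) from trivial)
      rw [← closure_artin, MonoidHom.map_closure] at this
      refine Subgroup.closure_mono ?_ this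
      rintro _ ⟨_, ⟨i, hi, rfl⟩, rfl⟩
      exact ⟨i, hi, rfl⟩
  exact (QuotientGroup.eq_one_iff _).mp this

lemma artin_sq_mul_inv_mem_commutator {i j : ℕ} (hi : i < n - 1) (hj : j < n - 1) :
    artin n i ^ 2 * (artin n j ^ 2)⁻¹ ∈ commutator (BraidGroup n) := by
  rw [mem_commutator_iff_abelianization, map_mul, map_inv, map_pow, map_pow,
    map_artin_eq_of_comm _ hi, map_artin_eq_of_comm _ hj, mul_inv_cancel]

/-- The element `σ₁² σ₃⁻²`, with 1-based indices. -/
def basicDiff (n : ℕ) : BraidGroup n := artin n 0 ^ 2 * (artin n 2 ^ 2)⁻¹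

lemma IsStandardPerm.basicDiff_mem (hμ : IsStandardPerm μ) (hn : 5 ≤ n) :
    basicDiff n ∈ commutator (BraidGroup n) ⊓ μ.ker :=
  ⟨artin_sq_mul_inv_mem_commutator (by omega) (by omega),
    μ.ker.mul_mem (hμ.artin_sq_mem_ker (by omega))
      (μ.ker.inv_mem (hμ.artin_sq_mem_ker (by omega)))⟩

lemma IsStandardPerm.commutator_inf_ker_le (hμ : IsStandardPerm μ) (hn : 5 ≤ n) :
    commutator (BraidGroup n) ⊓ μ.ker ≤ Subgroup.normalClosure {basicDiff n} := by
  set K := Subgroup.normalClosure {basicDiff n} with hK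
  have hKle : K ≤ commutator (BraidGroup n) := Subgroup.normalClosure_le_normal (by
    rintro _ rfl
    exact (hμ.basicDiff_mem hn).1)
  let q := QuotientGroup.mk' K
  have e02 : q (artin n 0 ^ 2) = q (artin n 2 ^ 2) := by
    rw [← mul_inv_eq_one, ← map_inv, ← map_mul]
    exact (QuotientGroup.eq_one_iff _).mpr (Subgroup.subset_normalClosure rfl)
  have conj_eq : ∀ {g a b a' b' : BraidGroup n}, g * a * g⁻¹ = a' → g * b * g⁻¹ = b' →
      q (a ^ 2) = q (b ^ 2) → q (a' ^ 2) = q (b' ^ 2) := by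
    rintro g a b _ _ rfl rfl h
    rw [conj_pow, conj_pow, map_mul, map_mul, map_mul, map_mul, h]
  have fixed : ∀ {g a : BraidGroup n}, Commute g a → g * a * g⁻¹ = a := fun h => by
    rw [h.eq, mul_inv_cancel_right]
  have e03 : q (artin n 0 ^ 2) = q (artin n 3 ^ 2) :=
    conj_eq (fixed ((artin_commute (show 0 + 2 ≤ 2 by omega)).symm.mul_left
      (artin_commute (show 0 + 2 ≤ 3 by omega)).symm))
      (artin_conj_succ (show 2 + 1 < n - 1 by omega)) e02
  have e13 : q (artin n 1 ^ 2) = q (artin n 3 ^ 2) :=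
    conj_eq (artin_conj_succ (show 0 + 1 < n - 1 by omega))
      (fixed ((artin_commute (show 0 + 2 ≤ 3 by omega)).mul_left
      (artin_commute (show 1 + 2 ≤ 3 by omega)))) e03
  have central : ∀ g, q g * q (artin n 0 ^ 2) = q (artin n 0 ^ 2) * q g := by
    intro g
    let H : Subgroup (BraidGroup n) := (Subgroup.centralizer {q (artin n 0 ^ 2)}).comap q
    suffices g ∈ H from (Subgroup.mem_centralizer_singleton_iff.mp this)
    refine artin_induction H (fun i hi => Subgroup.mem_centralizer_singleton_iff.mpr ?_) g
    have hcomm : ∀ {a b : BraidGroup n}, Commute a b →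
        q a * q (b ^ 2) = q (b ^ 2) * q a := fun h => by
      rw [← map_mul, ← map_mul, (h.pow_right 2).eq]
    rcases Nat.lt_or_ge i 2 with h | h
    · rcases Nat.lt_or_ge i 1 with h' | h'
      · obtain rfl : i = 0 := by omega
        exact hcomm (Commute.refl _)
      · obtain rfl : i = 1 := by omega
        rw [e03, ← e13]
        exact hcomm (Commute.refl _)
    · exact hcomm (artin_commute (show 0 + 2 ≤ i by omega)).symm
  have hnormal : (Subgroup.zpowers (q (artin n 0 ^ 2))).Normal := by
    refine ⟨fun x hx g => ?_⟩
    obtain ⟨k, rfl⟩ := Subgroup.mem_zpowers_iff.mp hx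
    obtain ⟨g, rfl⟩ := QuotientGroup.mk'_surjective K g
    have : Commute (q g) (q (artin n 0 ^ 2) ^ k) := Commute.zpow_right (central g) k
    change q g * _ * (q g)⁻¹ ∈ _
    rw [this.eq, mul_inv_cancel_right]
    exact hx
  rintro x ⟨hx1, hx2⟩
  have hx3 : x ∈ (Subgroup.zpowers (q (artin n 0 ^ 2))).comap q :=
    (Subgroup.normalClosure_le_normal (by
      rintro _ rfl
      exact Subgroup.mem_zpowers _)) (hμ.ker_le_normalClosure (by omega) hx2)
  obtain ⟨k, hk⟩ := Subgroup.mem_zpowers_iff.mp hx3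
  rw [← map_zpow] at hk
  have hmem : ((artin n 0 ^ 2) ^ k)⁻¹ * x ∈ K := QuotientGroup.eq.mp hk
  have hdeg := mul_mem (hKle hmem) (inv_mem hx1)
  rw [mul_inv_cancel_right] at hdeg
  have hdeg' := commutator_le_ker (braidDegree n) hdeg
  rw [MonoidHom.mem_ker, map_inv, map_zpow, map_pow, braidDegree_artin (by omega), inv_eq_one,
    ← ofAdd_nsmul, ← ofAdd_zsmul, ofAdd_eq_one] at hdeg'
  have hk0 : k = 0 := by simpa using hdeg'
  subst hk0
  simpa using hmem

open scoped commutatorElement in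
/-- Modulo `[J, J]`, where `J` is the degree-zero pure braid group, pure braids commute. -/
lemma IsStandardPerm.commutator_ker_le (hμ : IsStandardPerm μ) (hn : 5 ≤ n) :
    ⁅μ.ker, μ.ker⁆ ≤
      ⁅commutator (BraidGroup n) ⊓ μ.ker, commutator (BraidGroup n) ⊓ μ.ker⁆ := by
  set J := commutator (BraidGroup n) ⊓ μ.ker with hJ
  set a := artin n 0 ^ 2 with ha
  let q := QuotientGroup.mk' ⁅J, J⁆
  have hq : ∀ {x y : BraidGroup n}, Commute (q x) (q y) ↔ ⁅x, y⁆ ∈ ⁅J, J⁆ := by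
    intro x y
    rw [← commutatorElement_eq_one_iff_commute, ← map_commutatorElement]
    exact QuotientGroup.eq_one_iff _
  have hJJ : ∀ x ∈ J, ∀ y ∈ J, Commute (q x) (q y) := fun x hx y hy =>
    hq.mpr (Subgroup.commutator_mem_commutator hx hy)
  have decomp : ∀ p ∈ μ.ker, ∃ j ∈ J, ∃ k : ℤ, p = j * a ^ k := by
    intro p hp
    obtain ⟨d, hd⟩ := hμ.exists_sq (k := 0) (by omega) (g := p) (by rw [hp, map_one])
    exact ⟨p * a ^ d, ⟨hd, mul_mem hp (zpow_mem (hμ.artin_sq_mem_ker (by omega)) d)⟩, -d, by group⟩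
  have haJ : ∀ x ∈ J, Commute (q a) (q x) := by
    have hle : J ≤ ((Subgroup.centralizer (q '' μ.ker)).comap q) := by
      have : ((Subgroup.centralizer (q '' μ.ker)).comap q).Normal := by
        refine ⟨fun x hx g => ?_⟩
        simp only [Subgroup.mem_comap, Subgroup.mem_centralizer_iff, Set.forall_mem_image] at hx ⊢
        intro p hp
        have := hx (show g⁻¹ * p * g ∈ μ.ker by
          simpa using (MonoidHom.normal_ker μ).conj_mem p hp g⁻¹)
        calc q p * q (g * x * g⁻¹) = q g * (q (g⁻¹ * p * g) * q x) * (q g)⁻¹ := by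
              simp only [map_mul, map_inv]; group
          _ = _ := by rw [this]; simp only [map_mul, map_inv]; group
      refine (hμ.commutator_inf_ker_le hn).trans (Subgroup.normalClosure_le_normal ?_)
      rintro _ rfl
      simp only [SetLike.mem_coe, Subgroup.mem_comap, Subgroup.mem_centralizer_iff,
        Set.forall_mem_image]
      intro p hp
      obtain ⟨j, hj, k, rfl⟩ := decomp p hp
      have h1 : Commute a (basicDiff n) := (Commute.refl a).mul_right
        (((artin_commute (show 0 + 2 ≤ 2 by omega)).pow_pow 2 2).inv_right)
      rw [map_mul]
      exact ((hJJ j hj _ (hμ.basicDiff_mem hn)).mul_left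
        ((h1.zpow_left k).map q)).eq
    intro x hx
    exact Subgroup.mem_centralizer_iff.mp (hle hx) _ ⟨a, hμ.artin_sq_mem_ker (by omega), rfl⟩
  rw [Subgroup.commutator_le]
  intro x hx y hy
  obtain ⟨i, hi, k, rfl⟩ := decomp x hx
  obtain ⟨j, hj, l, rfl⟩ := decomp y hy
  rw [← hq]
  simp only [map_mul, map_zpow]
  exact ((hJJ i hi j hj).mul_right (((haJ i hi).zpow_left l).symm)).mul_left
    (((haJ j hj).zpow_left k).mul_right ((Commute.refl _).zpow_zpow k l))

end Pure

section Linking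

/-- Permutations acting on families indexed by unordered pairs. -/
def permArrow (n : ℕ) :
    Equiv.Perm (Fin n) →* MulAut (Sym2 (Fin n) → Multiplicative ℤ) where
  toFun π :=
    { toFun := fun v p => v (Sym2.map ⇑π⁻¹ p)
      invFun := fun v p => v (Sym2.map ⇑π p)
      left_inv := fun v => by
        funext p
        simp [Sym2.map_map]
      right_inv := fun v => by
        funext p
        simp [Sym2.map_map]
      map_mul' := fun _ _ => rfl }
  map_one' := by
    ext v p
    simp
  map_mul' π ρ := by
    ext v p
    simp only [mul_inv_rev, Equiv.Perm.coe_mul, MulAut.mul_apply, MulEquiv.coe_mk,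
      Equiv.coe_fn_mk, Sym2.map_map]

lemma permArrow_apply {n : ℕ} (π : Equiv.Perm (Fin n)) (v : Sym2 (Fin n) → Multiplicative ℤ)
    (p : Sym2 (Fin n)) : permArrow n π v p = v (Sym2.map ⇑π⁻¹ p) := rfl

lemma sym2_map_inv_eq_iff {α : Type*} (π : Equiv.Perm α) (p q : Sym2 α) :
    Sym2.map ⇑π⁻¹ p = q ↔ p = Sym2.map ⇑π q := by
  constructor
  · rintro rfl
    simp [Sym2.map_map]
  · rintro rfl
    simp [Sym2.map_map]

/-- A crossing of the strands labelled by `a` and `b`. -/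
def crossing {n : ℕ} (a b : Fin n) :
    (Sym2 (Fin n) → Multiplicative ℤ) ⋊[permArrow n] Equiv.Perm (Fin n) :=
  ⟨Pi.mulSingle s(a, b) (Multiplicative.ofAdd 1), Equiv.swap a b⟩

lemma permArrow_mulSingle {n : ℕ} (π : Equiv.Perm (Fin n)) (p : Sym2 (Fin n)) :
    permArrow n π (Pi.mulSingle p (Multiplicative.ofAdd 1)) =
      Pi.mulSingle (Sym2.map π p) (Multiplicative.ofAdd 1) := by
  funext q
  simp only [permArrow_apply, Pi.mulSingle_apply, sym2_map_inv_eq_iff]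

lemma crossing_comm {n : ℕ} {a b c d : Fin n} (hab : a ≠ b) (hcd : c ≠ d) (hac : a ≠ c)
    (had : a ≠ d) (hbc : b ≠ c) (hbd : b ≠ d) : crossing a b * crossing c d = crossing c d * crossing a b := by
  ext1
  · simp only [crossing, SemidirectProduct.mul_left, permArrow_mulSingle, Sym2.map_mk]
    rw [Equiv.swap_apply_of_ne_of_ne hac.symm hbc.symm,
      Equiv.swap_apply_of_ne_of_ne had.symm hbd.symm, Equiv.swap_apply_of_ne_of_ne hac had,
      Equiv.swap_apply_of_ne_of_ne hbc hbd, mul_comm]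
  · simp only [crossing, SemidirectProduct.mul_right]
    exact (Equiv.Perm.disjoint_swap_swap (by simp [*, List.nodup_cons])).commute.eq

lemma crossing_braid {n : ℕ} {a b c : Fin n} (hab : a ≠ b) (hac : a ≠ c) (hbc : b ≠ c) :
    crossing a b * crossing b c * crossing a b = crossing b c * crossing a b * crossing b c := by
  ext1
  · simp only [crossing, SemidirectProduct.mul_left, SemidirectProduct.mul_right,
      permArrow_mulSingle, Sym2.map_mk, Equiv.Perm.mul_apply, Equiv.swap_apply_left,
      Equiv.swap_apply_right, Equiv.swap_apply_of_ne_of_ne hac.symm hbc.symm,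
      Equiv.swap_apply_of_ne_of_ne hab hac]
    rw [mul_right_comm, mul_comm, mul_assoc, mul_comm (Pi.mulSingle s(a, b) _), mul_left_comm]
  · simp only [crossing, SemidirectProduct.mul_right]
    rw [Equiv.swap_mul_swap_mul_swap hab hac, Equiv.swap_comm a b, Equiv.swap_comm b c,
      Equiv.swap_mul_swap_mul_swap hbc.symm hac.symm, Equiv.swap_comm]

/-- The permutation of a braid together with its crossing numbers for all pairs of strands. -/
def linkingHom (n : ℕ) :
    BraidGroup n →* (Sym2 (Fin n) → Multiplicative ℤ) ⋊[permArrow n] Equiv.Perm (Fin n) :=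
  PresentedGroup.toGroup (f := fun i : Fin (n - 1) =>
    crossing ⟨i, by have := i.isLt; omega⟩ ⟨(i : ℕ) + 1, by have := i.isLt; omega⟩) <| by
    rintro _ (⟨i, j, h, rfl⟩ | ⟨i, j, h, rfl⟩)
    · simp only [map_mul, map_inv, FreeGroup.lift_apply_of]
      rw [mul_inv_eq_one, mul_inv_eq_iff_eq_mul]
      apply crossing_comm <;> simp only [ne_eq, Fin.mk.injEq] <;> omega
    · simp only [map_mul, map_inv, FreeGroup.lift_apply_of, h]
      rw [mul_inv_eq_one]
      apply crossing_braid <;> simp only [ne_eq, Fin.mk.injEq] <;> omega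

lemma linkingHom_artin {n i : ℕ} (h : i + 1 < n) :
    linkingHom n (artin n i) = crossing ⟨i, by omega⟩ ⟨i + 1, h⟩ := by
  rw [artin_of_lt (by omega)]
  exact PresentedGroup.toGroup.of _

/-- The signed number of crossings between a pair of strands of a braid. -/
def linking {n : ℕ} (x : BraidGroup n) (p : Sym2 (Fin n)) : ℤ :=
  Multiplicative.toAdd ((linkingHom n x).left p)

variable {n : ℕ} {μ : BraidGroup n →* Equiv.Perm (Fin n)}

lemma IsStandardPerm.linkingHom_right (hμ : IsStandardPerm μ) (x : BraidGroup n) :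
    (linkingHom n x).right = μ x := by
  refine artin_induction (MonoidHom.eqLocus (SemidirectProduct.rightHom.comp (linkingHom n)) μ)
    (fun i hi => ?_) x
  change (linkingHom n (artin n i)).right = μ (artin n i)
  rw [linkingHom_artin (by omega), hμ i (by omega)]
  rfl

lemma linking_one (p : Sym2 (Fin n)) : linking (1 : BraidGroup n) p = 0 := by
  simp [linking]

lemma IsStandardPerm.linking_mul (hμ : IsStandardPerm μ) (x y : BraidGroup n)
    (p : Sym2 (Fin n)) :
    linking (x * y) p = linking x p + linking y (Sym2.map ⇑(μ x)⁻¹ p) := by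
  rw [linking, map_mul, SemidirectProduct.mul_left, hμ.linkingHom_right]
  rfl

lemma linking_artin {i : ℕ} (h : i + 1 < n) (p : Sym2 (Fin n)) :
    linking (artin n i) p = if p = s(⟨i, by omega⟩, ⟨i + 1, h⟩) then 1 else 0 := by
  rw [linking, linkingHom_artin h, crossing]
  simp only [Pi.mulSingle_apply]
  split_ifs <;> rfl

lemma IsStandardPerm.linking_mul_of_mem_ker (hμ : IsStandardPerm μ) {x : BraidGroup n}
    (hx : x ∈ μ.ker) (y : BraidGroup n) (p : Sym2 (Fin n)) :
    linking (x * y) p = linking x p + linking y p := by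
  rw [hμ.linking_mul, MonoidHom.mem_ker.mp hx]
  simp

lemma IsStandardPerm.linking_inv_of_mem_ker (hμ : IsStandardPerm μ) {x : BraidGroup n}
    (hx : x ∈ μ.ker) (p : Sym2 (Fin n)) : linking x⁻¹ p = -linking x p := by
  have := hμ.linking_mul_of_mem_ker hx x⁻¹ p
  rw [mul_inv_cancel, linking_one] at this
  omega

lemma IsStandardPerm.linking_conj (hμ : IsStandardPerm μ) (g : BraidGroup n) {x : BraidGroup n}
    (hx : x ∈ μ.ker) (p : Sym2 (Fin n)) :
    linking (g * x * g⁻¹) p = linking x (Sym2.map ⇑(μ g)⁻¹ p) := by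
  have h := hμ.linking_mul g g⁻¹ p
  rw [mul_inv_cancel, linking_one] at h
  rw [hμ.linking_mul, hμ.linking_mul, map_mul, MonoidHom.mem_ker.mp hx, mul_one]
  omega

lemma IsStandardPerm.linking_artin_sq (hμ : IsStandardPerm μ) {i : ℕ} (h : i + 1 < n)
    (p : Sym2 (Fin n)) :
    linking (artin n i ^ 2) p = if p = s(⟨i, by omega⟩, ⟨i + 1, h⟩) then 2 else 0 := by
  have hp : Sym2.map ⇑(Equiv.swap (⟨i, by omega⟩ : Fin n) ⟨i + 1, h⟩)⁻¹ p =
      s(⟨i, by omega⟩, ⟨i + 1, h⟩) ↔ p = s(⟨i, by omega⟩, ⟨i + 1, h⟩) := by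
    rw [sym2_map_inv_eq_iff, Sym2.map_mk, Equiv.swap_apply_left, Equiv.swap_apply_right,
      Sym2.eq_swap]
  rw [sq, hμ.linking_mul, linking_artin h, linking_artin h, hμ i h]
  simp only [hp]
  split_ifs <;> rfl

/-- A permutation preserving `{0, 1}` lifts to a braid commuting with the first generator. -/
lemma IsStandardPerm.exists_commute_lift (hμ : IsStandardPerm μ) (hn : 2 ≤ n)
    {π : Equiv.Perm (Fin n)}
    (hπ : Sym2.map π s(⟨0, by omega⟩, ⟨1, by omega⟩) = s(⟨0, by omega⟩, ⟨1, by omega⟩)) :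
    ∃ c : BraidGroup n, Commute c (artin n 0) ∧ μ c = π := by
  set K := (Subgroup.centralizer {artin n 0}).map μ with hK
  suffices π ∈ K by
    obtain ⟨c, hc, rfl⟩ := this
    exact ⟨c, Subgroup.mem_centralizer_singleton_iff.mp hc, rfl⟩
  have hgen : ∀ i (h : i + 1 < n), Commute (artin n i) (artin n 0) →
      Equiv.swap (⟨i, by omega⟩ : Fin n) ⟨i + 1, h⟩ ∈ K := fun i h hc =>
    ⟨artin n i, Subgroup.mem_centralizer_singleton_iff.mpr hc, hμ i h⟩
  have hlt : ∀ d i (h : i + d + 1 < n), 2 ≤ i →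
      Equiv.swap (⟨i, by omega⟩ : Fin n) ⟨i + d + 1, h⟩ ∈ K := by
    intro d
    induction d with
    | zero => exact fun i h h2 => hgen i h (artin_commute (show 0 + 2 ≤ i by omega)).symm
    | succ d ih =>
      intro i h h2
      have h1 := hgen (i + (d + 1)) h (artin_commute (show 0 + 2 ≤ i + (d + 1) by omega)).symm
      have h3 := mul_mem (mul_mem h1 (ih i (by omega) h2)) h1
      change Equiv.swap (⟨i + d + 1, by omega⟩ : Fin n) _ * _ *
        Equiv.swap (⟨i + d + 1, by omega⟩ : Fin n) _ ∈ K at h3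
      rwa [Equiv.swap_mul_swap_mul_swap (by simp; omega) (by simp; omega), Equiv.swap_comm] at h3
  have hswap : ∀ i j : Fin n, 2 ≤ (i : ℕ) → 2 ≤ (j : ℕ) → i ≠ j → Equiv.swap i j ∈ K := by
    have aux : ∀ i j : Fin n, 2 ≤ (i : ℕ) → i < j → Equiv.swap i j ∈ K := by
      intro i j hi hij
      have hij' : (i : ℕ) < j := hij
      have := hlt (j - i - 1) i (by omega) hi
      convert this
      omega
    intro i j hi hj hne
    rcases lt_or_gt_of_ne hne with h | h
    · exact aux i j hi h
    · rw [Equiv.swap_comm]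
      exact aux j i hj h
  have hfix : ∀ ρ : Equiv.Perm (Fin n), ρ ⟨0, by omega⟩ = ⟨0, by omega⟩ →
      ρ ⟨1, by omega⟩ = ⟨1, by omega⟩ → ρ ∈ K := by
    intro ρ h0 h1
    have hsub : ∀ τ : Equiv.Perm {i : Fin n // 2 ≤ (i : ℕ)}, Equiv.Perm.ofSubtype τ ∈ K := by
      intro τ
      induction τ using Equiv.Perm.swap_induction_on with
      | one => simp [one_mem]
      | swap_mul τ x y hxy ih =>
        rw [map_mul, Equiv.Perm.ofSubtype_swap_eq]
        exact mul_mem (hswap x y x.2 y.2 (by simpa [Subtype.ext_iff] using hxy)) ih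
    have hsmall : ∀ i : Fin n, ¬ 2 ≤ (i : ℕ) → ρ i = i := by
      intro i hi
      obtain h | h : (i : ℕ) = 0 ∨ (i : ℕ) = 1 := by omega
      · rwa [show i = ⟨0, by omega⟩ from Fin.ext h]
      · rwa [show i = ⟨1, by omega⟩ from Fin.ext h]
    have hmem : ∀ i : Fin n, 2 ≤ (ρ i : ℕ) ↔ 2 ≤ (i : ℕ) := by
      intro i
      by_cases h2 : 2 ≤ (i : ℕ)
      · simp only [h2, iff_true]
        by_contra h3
        have := ρ.injective (hsmall _ h3)
        rw [this] at h3
        exact h3 h2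
      · rw [hsmall i h2]
    have := hsub (ρ.subtypePerm hmem)
    rwa [Equiv.Perm.ofSubtype_subtypePerm] at this
    intro i hi
    by_contra h2
    exact hi (hsmall i h2)
  rw [Sym2.map_mk, Sym2.eq_iff] at hπ
  rcases hπ with ⟨h0, h1⟩ | ⟨h0, h1⟩
  · exact hfix π h0 h1
  · have h01 : Equiv.swap (⟨0, by omega⟩ : Fin n) ⟨1, by omega⟩ ∈ K :=
      hgen 0 (by omega) (Commute.refl _)
    have hρ : Equiv.swap (⟨0, by omega⟩ : Fin n) ⟨1, by omega⟩ * π ∈ K := hfix _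
      (by rw [Equiv.Perm.mul_apply, h0, Equiv.swap_apply_right])
      (by rw [Equiv.Perm.mul_apply, h1, Equiv.swap_apply_left])
    have := mul_mem h01 hρ
    rwa [← mul_assoc, Equiv.swap_mul_self, one_mul] at this

lemma IsStandardPerm.conj_sq_mem_ker (hμ : IsStandardPerm μ) (hn : 2 ≤ n) (g : BraidGroup n) :
    g * artin n 0 ^ 2 * g⁻¹ ∈ μ.ker :=
  (MonoidHom.normal_ker μ).conj_mem _ (hμ.artin_sq_mem_ker (by omega)) g

/-- In the abelianized pure braid group, a conjugate of `σ₁²` depends only on the pair of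
strands it links. -/
lemma IsStandardPerm.abelianization_conj_eq (hμ : IsStandardPerm μ) (hn : 2 ≤ n)
    {g h : BraidGroup n}
    (hgh : Sym2.map (μ g) s(⟨0, by omega⟩, ⟨1, by omega⟩) =
      Sym2.map (μ h) s(⟨0, by omega⟩, ⟨1, by omega⟩)) :
    Abelianization.of (⟨_, hμ.conj_sq_mem_ker hn g⟩ : μ.ker) =
      Abelianization.of (⟨_, hμ.conj_sq_mem_ker hn h⟩ : μ.ker) := by
  obtain ⟨c, hc, hcμ⟩ := hμ.exists_commute_lift hn (π := μ (h⁻¹ * g)) (by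
    rw [map_mul, map_inv, Equiv.Perm.coe_mul, ← Sym2.map_map, hgh, sym2_map_inv_eq_iff])
  have hp : h * (h⁻¹ * g * c⁻¹) * h⁻¹ ∈ μ.ker :=
    (MonoidHom.normal_ker μ).conj_mem _ (by
      rw [MonoidHom.mem_ker, map_mul, map_inv, hcμ, mul_inv_cancel]) h
  have hc2 : c * artin n 0 ^ 2 * c⁻¹ = artin n 0 ^ 2 := by
    rw [(hc.pow_right 2).eq, mul_inv_cancel_right]
  have : (⟨_, hμ.conj_sq_mem_ker hn g⟩ : μ.ker) =
      ⟨_, hp⟩ * ⟨_, hμ.conj_sq_mem_ker hn h⟩ * ⟨_, hp⟩⁻¹ := by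
    ext1
    simp only [Subgroup.coe_mul, Subgroup.coe_inv]
    conv_rhs => rw [← hc2]
    group
  rw [this, map_mul, map_mul, map_inv, mul_inv_cancel_comm]

lemma IsStandardPerm.exists_basis (hμ : IsStandardPerm μ) (hn : 2 ≤ n) :
    ∃ A : Sym2 (Fin n) → Abelianization μ.ker, ∀ g : BraidGroup n,
      A (Sym2.map (μ g) s(⟨0, by omega⟩, ⟨1, by omega⟩)) =
        Abelianization.of ⟨_, hμ.conj_sq_mem_ker hn g⟩ := by
  classical
  refine ⟨fun p => if h : ∃ g : BraidGroup n,
    Sym2.map (μ g) s(⟨0, by omega⟩, ⟨1, by omega⟩) = p then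
      Abelianization.of ⟨_, hμ.conj_sq_mem_ker hn h.choose⟩ else 1, fun g => ?_⟩
  have h : ∃ g' : BraidGroup n, Sym2.map (μ g') s(⟨0, by omega⟩, ⟨1, by omega⟩) =
    Sym2.map (μ g) s(⟨0, by omega⟩, ⟨1, by omega⟩) := ⟨g, rfl⟩
  simp only [dif_pos h]
  exact hμ.abelianization_conj_eq hn h.choose_spec

/-- The class of a pure braid in the abelianization is determined by its linking numbers. -/
lemma IsStandardPerm.exists_linking_eq (hμ : IsStandardPerm μ) (hn : 2 ≤ n) :
    ∃ A : Sym2 (Fin n) → Abelianization μ.ker, ∀ x : μ.ker, ∃ m : Sym2 (Fin n) → ℤ,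
      (∀ p, linking (x : BraidGroup n) p = 2 * m p) ∧ (∀ p, p.IsDiag → m p = 0) ∧
      Abelianization.of x = ∏ p, A p ^ m p := by
  classical
  obtain ⟨A, hA⟩ := hμ.exists_basis hn
  refine ⟨A, ?_⟩
  rintro ⟨x, hx⟩
  have hx' := hμ.ker_le_normalClosure hn hx
  rw [Subgroup.normalClosure] at hx'
  have hle : ∀ y ∈ Subgroup.closure (Group.conjugatesOfSet {artin n 0 ^ 2}), y ∈ μ.ker :=
    fun y hy => Subgroup.normalClosure_le_normal (by
      rintro _ rfl
      exact hμ.artin_sq_mem_ker (by omega)) hy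
  induction hx' using Subgroup.closure_induction with
  | mem y hy =>
    obtain ⟨_, rfl, hy⟩ := Group.mem_conjugatesOfSet_iff.mp hy
    obtain ⟨g, rfl⟩ := isConj_iff.mp hy
    refine ⟨fun p => if p = Sym2.map (μ g) s(⟨0, by omega⟩, ⟨1, by omega⟩) then 1 else 0,
      fun p => ?_, fun p hp => ?_, ?_⟩
    · rw [hμ.linking_conj g (hμ.artin_sq_mem_ker (by omega)),
        hμ.linking_artin_sq (i := 0) (by omega)]
      simp only [sym2_map_inv_eq_iff, zero_add]
      split_ifs <;> rfl
    · refine if_neg ?_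
      rintro rfl
      simp at hp
    · rw [Fintype.prod_eq_single (Sym2.map (μ g) s(⟨0, by omega⟩, ⟨1, by omega⟩))
        (fun p hp => by simp only [if_neg hp, zpow_zero])]
      simp only [if_true, zpow_one, hA]
  | one =>
    exact ⟨0, fun p => by simp [linking_one], fun _ _ => rfl, by
      simp only [Pi.zero_apply, zpow_zero, Finset.prod_const_one]
      exact map_one _⟩
  | mul y z hy hz ihy ihz =>
    obtain ⟨m, h1, h2, h3⟩ := ihy (hle y hy)
    obtain ⟨m', h1', h2', h3'⟩ := ihz (hle z hz)
    refine ⟨m + m', fun p => ?_, fun p hp => by simp [h2 p hp, h2' p hp], ?_⟩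
    · rw [Pi.add_apply, mul_add, ← h1, ← h1', hμ.linking_mul_of_mem_ker (hle y hy)]
    · simp only [Pi.add_apply, zpow_add, Finset.prod_mul_distrib]
      rw [← h3, ← h3', ← map_mul]
      rfl
  | inv y hy ih =>
    obtain ⟨m, h1, h2, h3⟩ := ih (hle y hy)
    refine ⟨-m, fun p => ?_, fun p hp => by simp [h2 p hp], ?_⟩
    · rw [Pi.neg_apply, mul_neg, ← h1, hμ.linking_inv_of_mem_ker (hle y hy)]
    · simp only [Pi.neg_apply, zpow_neg, Finset.prod_inv_distrib]
      rw [← h3, ← map_inv]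
      rfl

lemma IsStandardPerm.linking_even (hμ : IsStandardPerm μ) (hn : 2 ≤ n) {x : BraidGroup n}
    (hx : x ∈ μ.ker) (p : Sym2 (Fin n)) : Even (linking x p) := by
  obtain ⟨A, hA⟩ := hμ.exists_linking_eq hn
  obtain ⟨m, hm, -⟩ := hA ⟨x, hx⟩
  exact ⟨m p, by rw [← two_mul]; exact hm p⟩

lemma IsStandardPerm.linking_of_isDiag (hμ : IsStandardPerm μ) (hn : 2 ≤ n) {x : BraidGroup n}
    (hx : x ∈ μ.ker) {p : Sym2 (Fin n)} (hp : p.IsDiag) : linking x p = 0 := by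
  obtain ⟨A, hA⟩ := hμ.exists_linking_eq hn
  obtain ⟨m, hm, hm', -⟩ := hA ⟨x, hx⟩
  have := hm p
  rwa [hm' p hp, mul_zero] at this

lemma IsStandardPerm.mem_commutator_of_linking_eq_zero (hμ : IsStandardPerm μ) (hn : 5 ≤ n)
    {x : BraidGroup n} (hx : x ∈ μ.ker) (h : ∀ p, linking x p = 0) :
    x ∈ ⁅commutator (BraidGroup n) ⊓ μ.ker, commutator (BraidGroup n) ⊓ μ.ker⁆ := by
  obtain ⟨A, hA⟩ := hμ.exists_linking_eq (by omega)
  obtain ⟨m, hm, -, hof⟩ := hA ⟨x, hx⟩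
  have hm0 : ∀ p, m p = 0 := fun p => by
    have := hm p
    rw [h p] at this
    omega
  simp only [hm0, zpow_zero, Finset.prod_const_one] at hof
  rw [← mem_commutator_iff_abelianization] at hof
  refine hμ.commutator_ker_le hn ?_
  have := Subgroup.mem_map_of_mem μ.ker.subtype hof
  rwa [commutator_def, Subgroup.map_commutator, ← MonoidHom.range_eq_map,
    Subgroup.range_subtype] at this

lemma IsStandardPerm.linking_eq_zero_of_mem_commutator (hμ : IsStandardPerm μ)
    {x : BraidGroup n} (hx : x ∈ ⁅μ.ker, μ.ker⁆) (p : Sym2 (Fin n)) : linking x p = 0 := by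
  let f : μ.ker →* Multiplicative ℤ :=
    { toFun := fun x => Multiplicative.ofAdd (linking (x : BraidGroup n) p)
      map_one' := by simp [linking_one]
      map_mul' := fun x y => by
        rw [Subgroup.coe_mul, hμ.linking_mul_of_mem_ker x.2, ofAdd_add] }
  have h1 : x ∈ (commutator μ.ker).map μ.ker.subtype := by
    rwa [commutator_def, Subgroup.map_commutator, ← MonoidHom.range_eq_map,
      Subgroup.range_subtype]
  obtain ⟨y, hy, rfl⟩ := h1
  exact ofAdd_eq_one.mp (MonoidHom.mem_ker.mp (commutator_le_ker f hy))

end Linking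

/-- A function on pairs that is invariant under the even permutations stabilizing
`{a₀, a₁}` and `{a₂, a₃}`, and is negated by those exchanging them, is a combination of the two
basic functions with this property. -/
lemma exists_eq_add_of_stabilizer {ι : Type*} [DecidableEq ι] [Fintype ι] (w : Sym2 ι → ℤ)
    (hw : ∀ p, Even (w p)) {a₀ a₁ a₂ a₃ a₄ : ι} (h01 : a₀ ≠ a₁) (h02 : a₀ ≠ a₂) (h03 : a₀ ≠ a₃)
    (h12 : a₁ ≠ a₂) (h13 : a₁ ≠ a₃) (h23 : a₂ ≠ a₃) (h04 : a₀ ≠ a₄) (h14 : a₁ ≠ a₄)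
    (h24 : a₂ ≠ a₄) (h34 : a₃ ≠ a₄)
    (hfix : ∀ π : Equiv.Perm ι, Equiv.Perm.sign π = 1 → s(π a₀, π a₁) = s(a₀, a₁) →
      s(π a₂, π a₃) = s(a₂, a₃) → ∀ k l, w s(π k, π l) = w s(k, l))
    (hneg : ∀ π : Equiv.Perm ι, Equiv.Perm.sign π = 1 → s(π a₀, π a₁) = s(a₂, a₃) →
      s(π a₂, π a₃) = s(a₀, a₁) → ∀ k l, w s(π k, π l) = -w s(k, l)) :
    ∃ α β : ℤ, ∀ k l, k ≠ l → w s(k, l) =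
      α * ((if s(k, l) = s(a₀, a₁) then 2 else 0) - (if s(k, l) = s(a₂, a₃) then 2 else 0)) +
      β * (((if k = a₀ ∨ k = a₁ then 2 else 0) - (if k = a₂ ∨ k = a₃ then 2 else 0)) +
        ((if l = a₀ ∨ l = a₁ then 2 else 0) - (if l = a₂ ∨ l = a₃ then 2 else 0))) := by
  obtain ⟨a, ha⟩ := hw s(a₀, a₁)
  obtain ⟨b, hb⟩ := hw s(a₀, a₄)
  obtain ⟨W, hW⟩ : ∃ W : ι → ι → ℤ, ∀ k l, w s(k, l) = W k l :=
    ⟨fun k l => w s(k, l), fun _ _ => rfl⟩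
  have hsymm : ∀ k l, W k l = W l k := fun k l => by rw [← hW, ← hW, Sym2.eq_swap]
  have sgn : ∀ {i j k l : ι}, i ≠ j → k ≠ l →
      Equiv.Perm.sign (Equiv.swap i j * Equiv.swap k l) = 1 := fun h h' => by
    rw [map_mul, Equiv.Perm.sign_swap h, Equiv.Perm.sign_swap h']
    rfl
  have ds : ∀ {i j k l : ι}, i ≠ k → i ≠ l → j ≠ k → j ≠ l →
      (Equiv.swap i j * Equiv.swap k l) i = j ∧ (Equiv.swap i j * Equiv.swap k l) j = i ∧
      (Equiv.swap i j * Equiv.swap k l) k = l ∧ (Equiv.swap i j * Equiv.swap k l) l = k ∧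
      ∀ m, m ≠ i → m ≠ j → m ≠ k → m ≠ l → (Equiv.swap i j * Equiv.swap k l) m = m := by
    intro i j k l hik hil hjk hjl
    refine ⟨?_, ?_, ?_, ?_, fun m h1 h2 h3 h4 => ?_⟩ <;>
      simp [Equiv.swap_apply_of_ne_of_ne, *, Ne.symm]
  obtain ⟨p0, p2, p1, p3, p4⟩ := ds (i := a₀) (j := a₂) (k := a₁) (l := a₃) h01 h03 h12.symm h23
  have f2 := hneg _ (sgn h02 h13) (by rw [p0, p1]) (by rw [p2, p3, Sym2.eq_swap])
  obtain ⟨q0, q3, q1, q2, q4⟩ :=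
    ds (i := a₀) (j := a₃) (k := a₁) (l := a₂) h01 h02 h13.symm h23.symm
  have f3 := hneg _ (sgn h03 h12) (by rw [q0, q1, Sym2.eq_swap]) (by rw [q2, q3, Sym2.eq_swap])
  simp only [hW] at *
  have w02 : W a₀ a₂ = 0 := by
    have := f2 a₀ a₂
    rw [p0, p2, hsymm] at this
    omega
  have w13 : W a₁ a₃ = 0 := by
    have := f2 a₁ a₃
    rw [p1, p3, hsymm] at this
    omega
  have w03 : W a₀ a₃ = 0 := by
    have := f3 a₀ a₃
    rw [q0, q3, hsymm] at this
    omega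
  have w12 : W a₁ a₂ = 0 := by
    have := f3 a₁ a₂
    rw [q1, q2, hsymm] at this
    omega
  have w23 : W a₂ a₃ = -(a + a) := by
    have := f2 a₀ a₁
    rwa [p0, p1, ha] at this
  have key : ∀ k, k ≠ a₀ → k ≠ a₁ → k ≠ a₂ → k ≠ a₃ → W a₂ k = -W a₀ k ∧ W a₃ k = -W a₀ k ∧
      W a₁ k = W a₀ k := by
    intro k k0 k1 k2 k3
    have e1 := f2 a₀ k
    have e2 := f3 a₀ k
    have e3 := f2 a₁ k
    rw [p0, p4 k k0 k2 k1 k3] at e1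
    rw [q0, q4 k k0 k3 k1 k2] at e2
    rw [p1, p4 k k0 k2 k1 k3] at e3
    omega
  have key0 : ∀ k, k ≠ a₀ → k ≠ a₁ → k ≠ a₂ → k ≠ a₃ → W a₀ k = b + b := by
    intro k k0 k1 k2 k3
    by_cases hk : k = a₄
    · rw [hk, hb]
    · obtain ⟨r0, r1, r4, rk, r⟩ :=
        ds (i := a₀) (j := a₁) (k := a₄) (l := k) h04 k0.symm h14 k1.symm
      have := hfix _ (sgn h01 (Ne.symm hk)) (by rw [r0, r1, Sym2.eq_swap])
        (by rw [r _ h02.symm h12.symm h24 k2.symm, r _ h03.symm h13.symm h34 k3.symm]) a₀ a₄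
      rw [r0, r4, (key k k0 k1 k2 k3).2.2, hb] at this
      exact this
  have key2 : ∀ k l, k ≠ a₀ → k ≠ a₁ → k ≠ a₂ → k ≠ a₃ → l ≠ a₀ → l ≠ a₁ → l ≠ a₂ → l ≠ a₃ →
      W k l = 0 := by
    intro k l k0 k1 k2 k3 l0 l1 l2 l3
    have := f2 k l
    rw [p4 k k0 k2 k1 k3, p4 l l0 l2 l1 l3] at this
    omega
  refine ⟨a - 2 * b, b, fun k l hkl => ?_⟩
  have five : ∀ k, k = a₀ ∨ k = a₁ ∨ k = a₂ ∨ k = a₃ ∨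
      (k ≠ a₀ ∧ k ≠ a₁ ∧ k ≠ a₂ ∧ k ≠ a₃) ∧ (W a₀ k = 2 * b ∧ W a₁ k = 2 * b ∧
        W a₂ k = -(2 * b) ∧ W a₃ k = -(2 * b)) ∧ (W k a₀ = 2 * b ∧ W k a₁ = 2 * b ∧
        W k a₂ = -(2 * b) ∧ W k a₃ = -(2 * b)) := by
    intro k
    by_cases h : k ≠ a₀ ∧ k ≠ a₁ ∧ k ≠ a₂ ∧ k ≠ a₃
    · obtain ⟨k0, k1, k2, k3⟩ := h
      obtain ⟨e2, e3, e1⟩ := key k k0 k1 k2 k3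
      have e0 := key0 k k0 k1 k2 k3
      rw [hsymm k a₀, hsymm k a₁, hsymm k a₂, hsymm k a₃]
      refine .inr <| .inr <| .inr <| .inr ⟨⟨k0, k1, k2, k3⟩, ?_⟩
      omega
    · tauto
  have h10 := hsymm a₁ a₀
  have h20 := hsymm a₂ a₀
  have h30 := hsymm a₃ a₀
  have h21 := hsymm a₂ a₁
  have h31 := hsymm a₃ a₁
  have h32 := hsymm a₃ a₂
  clear hneg hfix f2 f3 key key0 p0 p1 p2 p3 p4 q0 q1 q2 q3 q4 ds sgn hW hw hsymm
  rcases five k with rfl | rfl | rfl | rfl | ⟨⟨k0, k1, k2, k3⟩, -, e0, e1, e2, e3⟩ <;>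
  rcases five l with rfl | rfl | rfl | rfl | ⟨⟨l0, l1, l2, l3⟩, ⟨e0', e1', e2', e3'⟩, -⟩ <;>
  first
    | exact absurd rfl hkl
    | (simp [*, Ne.symm]; done)
    | (simp [*, Ne.symm]
       ring)

section Automorphism

variable {n : ℕ} {μ : BraidGroup n →* Equiv.Perm (Fin n)}

lemma IsStandardPerm.surjective (hμ : IsStandardPerm μ) : Function.Surjective μ := by
  rcases n with _ | n
  · exact fun π => ⟨1, Subsingleton.elim _ _⟩
  have h : ∀ π ∈ Submonoid.closure (Set.range fun i : Fin n => Equiv.swap i.castSucc i.succ),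
      π ∈ μ.range.toSubmonoid :=
    fun π hπ => Submonoid.closure_le.mpr (by
      rintro _ ⟨i, rfl⟩
      exact ⟨artin (n + 1) i, hμ i (by omega)⟩) hπ
  intro π
  exact h π (by rw [Equiv.Perm.mclosure_swap_castSucc_succ]; trivial)

lemma IsStandardPerm.exists_commutator_lift (hμ : IsStandardPerm μ) (hn : 2 ≤ n)
    {π : Equiv.Perm (Fin n)} (hπ : Equiv.Perm.sign π = 1) :
    ∃ g : commutator (BraidGroup n), μ g = π := by
  obtain ⟨g, rfl⟩ := hμ.surjective π
  obtain ⟨d, hd⟩ := hμ.exists_sq (k := 0) (by omega) hπ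
  refine ⟨⟨_, hd⟩, ?_⟩
  rw [map_mul, map_zpow, MonoidHom.mem_ker.mp (hμ.artin_sq_mem_ker (by omega)), one_zpow, mul_one]

lemma IsStandardPerm.linking_basicDiff (hμ : IsStandardPerm μ) (hn : 5 ≤ n) (p : Sym2 (Fin n)) :
    linking (basicDiff n) p =
      (if p = s(⟨0, by omega⟩, ⟨1, by omega⟩) then 2 else 0) -
      (if p = s(⟨2, by omega⟩, ⟨3, by omega⟩) then 2 else 0) := by
  rw [basicDiff, hμ.linking_mul_of_mem_ker (hμ.artin_sq_mem_ker (by omega)),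
    hμ.linking_inv_of_mem_ker (hμ.artin_sq_mem_ker (by omega)),
    hμ.linking_artin_sq (i := 0) (by omega), hμ.linking_artin_sq (i := 2) (by omega),
    sub_eq_add_neg]

/-- The total linking of a strand with all the strands. -/
def strandSum (x : BraidGroup n) (k : Fin n) : ℤ := ∑ m, linking x s(k, m)

lemma IsStandardPerm.strandSum_mul (hμ : IsStandardPerm μ) {x : BraidGroup n}
    (hx : x ∈ μ.ker) (y : BraidGroup n) (k : Fin n) :
    strandSum (x * y) k = strandSum x k + strandSum y k := by
  simp only [strandSum, hμ.linking_mul_of_mem_ker hx, Finset.sum_add_distrib]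

lemma IsStandardPerm.strandSum_inv (hμ : IsStandardPerm μ) {x : BraidGroup n}
    (hx : x ∈ μ.ker) (k : Fin n) : strandSum x⁻¹ k = -strandSum x k := by
  simp only [strandSum, hμ.linking_inv_of_mem_ker hx, Finset.sum_neg_distrib]

lemma IsStandardPerm.strandSum_conj (hμ : IsStandardPerm μ) (g : BraidGroup n) {x : BraidGroup n}
    (hx : x ∈ μ.ker) (k : Fin n) :
    strandSum (g * x * g⁻¹) k = strandSum x ((μ g)⁻¹ k) := by
  simp only [strandSum, hμ.linking_conj g hx, Sym2.map_mk]
  exact Equiv.sum_comp (μ g)⁻¹ fun m => linking x s((μ g)⁻¹ k, m)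

lemma sum_ite_mk_eq {ι : Type*} [DecidableEq ι] [Fintype ι] {a b : ι} (hab : a ≠ b) (k : ι)
    (c : ℤ) : ∑ m, (if s(k, m) = s(a, b) then c else 0) = if k = a ∨ k = b then c else 0 := by
  by_cases ha : k = a
  · subst ha
    simp only [Sym2.congr_right, Finset.sum_ite_eq', Finset.mem_univ, if_true, true_or]
  · by_cases hb : k = b
    · subst hb
      simp only [Sym2.eq_swap (a := a), Sym2.congr_right, Finset.sum_ite_eq', Finset.mem_univ,
        if_true, or_true]
    · simp [ha, hb]

lemma IsStandardPerm.strandSum_basicDiff (hμ : IsStandardPerm μ) (hn : 5 ≤ n) (k : Fin n) :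
    strandSum (basicDiff n) k =
      (if k = ⟨0, by omega⟩ ∨ k = ⟨1, by omega⟩ then 2 else 0) -
      (if k = ⟨2, by omega⟩ ∨ k = ⟨3, by omega⟩ then 2 else 0) := by
  simp only [strandSum, hμ.linking_basicDiff hn, Finset.sum_sub_distrib]
  rw [sum_ite_mk_eq (by simp), sum_ite_mk_eq (by simp)]

lemma map_subtype_Jsub (μ : BraidGroup n →* Equiv.Perm (Fin n)) :
    (Jsub n μ).map (commutator (BraidGroup n)).subtype = commutator (BraidGroup n) ⊓ μ.ker := by
  rw [Jsub, Subgroup.map_comap_eq, Subgroup.range_subtype]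

lemma mem_Jsub {x : commutator (BraidGroup n)} :
    x ∈ Jsub n μ ↔ (x : BraidGroup n) ∈ μ.ker := Iff.rfl

lemma mem_commutator_Jsub {x : commutator (BraidGroup n)} :
    x ∈ ⁅Jsub n μ, Jsub n μ⁆ ↔ (x : BraidGroup n) ∈
      ⁅commutator (BraidGroup n) ⊓ μ.ker, commutator (BraidGroup n) ⊓ μ.ker⁆ := by
  rw [← map_subtype_Jsub, ← Subgroup.map_commutator]
  exact (Subgroup.mem_map_iff_mem (Subgroup.subtype_injective _)).symm

variable {ψ : MulAut ↥(commutator (BraidGroup n))}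

lemma map_mem_Jsub_iff (hψ : ∀ x : ↥(commutator (BraidGroup n)), μ ↑(ψ x) = μ ↑x)
    {x : ↥(commutator (BraidGroup n))} : ψ x ∈ Jsub n μ ↔ x ∈ Jsub n μ := by
  rw [mem_Jsub, mem_Jsub, MonoidHom.mem_ker, MonoidHom.mem_ker, hψ]

lemma map_Jsub (hψ : ∀ x : ↥(commutator (BraidGroup n)), μ ↑(ψ x) = μ ↑x) :
    (Jsub n μ).map ψ.toMonoidHom = Jsub n μ := by
  ext x
  constructor
  · rintro ⟨y, hy, rfl⟩
    exact (map_mem_Jsub_iff hψ).mpr hy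
  · intro hx
    refine ⟨ψ.symm x, (map_mem_Jsub_iff hψ).mp ?_, ψ.apply_symm_apply x⟩
    rwa [ψ.apply_symm_apply]

lemma IsStandardPerm.linking_map_eq_zero (hμ : IsStandardPerm μ) (hn : 5 ≤ n)
    (hψ : ∀ x : ↥(commutator (BraidGroup n)), μ ↑(ψ x) = μ ↑x)
    {x : ↥(commutator (BraidGroup n))} (hx : x ∈ Jsub n μ)
    (h : ∀ p, linking (x : BraidGroup n) p = 0) (p : Sym2 (Fin n)) :
    linking (ψ x : BraidGroup n) p = 0 := by
  have h1 := mem_commutator_Jsub.mpr (hμ.mem_commutator_of_linking_eq_zero hn hx h)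
  have h2 := Subgroup.mem_map_of_mem ψ.toMonoidHom h1
  rw [Subgroup.map_commutator, map_Jsub hψ] at h2
  exact hμ.linking_eq_zero_of_mem_commutator
    (Subgroup.commutator_mono inf_le_right inf_le_right (mem_commutator_Jsub.mp h2)) p

lemma IsStandardPerm.linking_map_conj (hμ : IsStandardPerm μ)
    (hψ : ∀ x : ↥(commutator (BraidGroup n)), μ ↑(ψ x) = μ ↑x)
    (g : ↥(commutator (BraidGroup n))) {x : ↥(commutator (BraidGroup n))} (hx : x ∈ Jsub n μ)
    (p : Sym2 (Fin n)) :
    linking (ψ (g * x * g⁻¹) : BraidGroup n) p =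
      linking (ψ x : BraidGroup n) (Sym2.map ⇑(μ g)⁻¹ p) := by
  rw [map_mul, map_mul, map_inv, Subgroup.coe_mul, Subgroup.coe_mul, Subgroup.coe_inv,
    hμ.linking_conj _ (mem_Jsub.mp ((map_mem_Jsub_iff hψ).mpr hx)), hψ]

lemma IsStandardPerm.linking_zpow (hμ : IsStandardPerm μ) {x : BraidGroup n} (hx : x ∈ μ.ker)
    (e : ℤ) (p : Sym2 (Fin n)) : linking (x ^ e) p = e * linking x p := by
  induction e using Int.induction_on with
  | zero => simp [linking_one]
  | succ i ih =>
    rw [zpow_add_one, hμ.linking_mul_of_mem_ker (zpow_mem hx _), ih]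
    ring
  | pred i ih =>
    rw [zpow_sub_one, hμ.linking_mul_of_mem_ker (zpow_mem hx _), hμ.linking_inv_of_mem_ker hx, ih]
    ring

/-- If an even permutation multiplies the linking numbers of a braid by a sign, then it does so
after applying an automorphism. -/
lemma IsStandardPerm.linking_map_perm (hμ : IsStandardPerm μ) (hn : 5 ≤ n)
    (hψ : ∀ x : ↥(commutator (BraidGroup n)), μ ↑(ψ x) = μ ↑x)
    {x : ↥(commutator (BraidGroup n))} (hx : x ∈ Jsub n μ) {π : Equiv.Perm (Fin n)}
    (hπ : Equiv.Perm.sign π = 1) (e : ℤ)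
    (h : ∀ p, linking (x : BraidGroup n) (Sym2.map ⇑π⁻¹ p) = e * linking (x : BraidGroup n) p)
    (p : Sym2 (Fin n)) :
    linking (ψ x : BraidGroup n) (Sym2.map ⇑π⁻¹ p) = e * linking (ψ x : BraidGroup n) p := by
  obtain ⟨g, rfl⟩ := hμ.exists_commutator_lift (by omega) hπ
  have hzpow : ∀ {y : ↥(commutator (BraidGroup n))}, y ∈ Jsub n μ → ∀ q,
      linking ((y ^ e : ↥(commutator (BraidGroup n))) : BraidGroup n) q =
        e * linking (y : BraidGroup n) q := by
    intro y hy q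
    rw [Subgroup.coe_zpow, hμ.linking_zpow (mem_Jsub.mp hy)]
  have hgx : g * x * g⁻¹ ∈ Jsub n μ := (MonoidHom.normal_ker μ).conj_mem _ hx g
  have h0 := hμ.linking_map_eq_zero hn hψ (mul_mem hgx (inv_mem (zpow_mem hx e))) (fun q => by
    rw [Subgroup.coe_mul, hμ.linking_mul_of_mem_ker (mem_Jsub.mp hgx), Subgroup.coe_inv,
      hμ.linking_inv_of_mem_ker (mem_Jsub.mp (zpow_mem hx e)), hzpow hx, ← h, Subgroup.coe_mul,
      Subgroup.coe_mul, Subgroup.coe_inv, hμ.linking_conj _ (mem_Jsub.mp hx), add_neg_cancel]) p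
  rw [map_mul, Subgroup.coe_mul,
    hμ.linking_mul_of_mem_ker (mem_Jsub.mp ((map_mem_Jsub_iff hψ).mpr hgx)),
    hμ.linking_map_conj hψ g hx, map_inv, map_zpow, Subgroup.coe_inv,
    hμ.linking_inv_of_mem_ker (mem_Jsub.mp (zpow_mem ((map_mem_Jsub_iff hψ).mpr hx) e)),
    hzpow ((map_mem_Jsub_iff hψ).mpr hx)] at h0
  omega

/-- The element `σ₁² σ₃⁻²` of the commutator subgroup. -/
def basicDiff' (n : ℕ) (hn : 5 ≤ n) : ↥(commutator (BraidGroup n)) :=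
  ⟨basicDiff n, artin_sq_mul_inv_mem_commutator (by omega) (by omega)⟩

lemma IsStandardPerm.exists_linking_map_basicDiff (hμ : IsStandardPerm μ) (hn : 5 ≤ n)
    (hψ : ∀ x : ↥(commutator (BraidGroup n)), μ ↑(ψ x) = μ ↑x) :
    ∃ α β : ℤ, ∀ k l, k ≠ l → linking (ψ (basicDiff' n hn) : BraidGroup n) s(k, l) =
      α * linking (basicDiff n) s(k, l) +
        β * (strandSum (basicDiff n) k + strandSum (basicDiff n) l) := by
  have hc : basicDiff' n hn ∈ Jsub n μ := (hμ.basicDiff_mem hn).2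
  have hperm : ∀ (π : Equiv.Perm (Fin n)) (e : ℤ), Equiv.Perm.sign π = 1 →
      (∀ p, linking (basicDiff n) (Sym2.map ⇑π⁻¹ p) = e * linking (basicDiff n) p) →
      ∀ k l, e * linking (ψ (basicDiff' n hn) : BraidGroup n) s(π k, π l) =
        linking (ψ (basicDiff' n hn) : BraidGroup n) s(k, l) := by
    intro π e hπ h k l
    rw [← hμ.linking_map_perm hn hψ hc hπ e h]
    simp
  simp only [hμ.linking_basicDiff hn, hμ.strandSum_basicDiff hn]
  refine exists_eq_add_of_stabilizer (a₄ := ⟨4, by omega⟩)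
    (fun p => linking (ψ (basicDiff' n hn) : BraidGroup n) p)
    (fun p => hμ.linking_even (by omega) ((map_mem_Jsub_iff hψ).mpr hc) p)
    (by simp) (by simp) (by simp) (by simp) (by simp) (by simp) (by simp) (by simp) (by simp)
    (by simp) (fun π hπ h1 h2 k l => ?_) (fun π hπ h1 h2 k l => ?_)
  · refine (one_mul _).symm.trans (hperm π 1 hπ (fun p => ?_) k l)
    simp only [hμ.linking_basicDiff hn, sym2_map_inv_eq_iff, Sym2.map_mk, h1, h2, one_mul]
  · have := hperm π (-1) hπ (fun p => by
      simp only [hμ.linking_basicDiff hn, sym2_map_inv_eq_iff, Sym2.map_mk, h1, h2]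
      ring) k l
    linarith

lemma IsStandardPerm.exists_linking_map (hμ : IsStandardPerm μ) (hn : 5 ≤ n)
    (hψ : ∀ x : ↥(commutator (BraidGroup n)), μ ↑(ψ x) = μ ↑x) :
    ∃ α β : ℤ, ∀ x ∈ Jsub n μ, ∀ k l, k ≠ l → linking (ψ x : BraidGroup n) s(k, l) =
      α * linking (x : BraidGroup n) s(k, l) +
        β * (strandSum (x : BraidGroup n) k + strandSum (x : BraidGroup n) l) := by
  obtain ⟨α, β, hαβ⟩ := hμ.exists_linking_map_basicDiff hn hψ
  refine ⟨α, β, ?_⟩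
  rintro ⟨x, hx⟩ hxJ
  have hx' := hμ.commutator_inf_ker_le hn ⟨hx, hxJ⟩
  have hle : Subgroup.normalClosure {basicDiff n} ≤ commutator (BraidGroup n) ⊓ μ.ker :=
    Subgroup.normalClosure_le_normal (by
      rintro _ rfl
      exact hμ.basicDiff_mem hn)
  rw [Subgroup.normalClosure] at hx' hle
  clear hxJ
  induction hx' using Subgroup.closure_induction with
  | mem y hy =>
    intro k l hkl
    obtain ⟨_, rfl, hy⟩ := Group.mem_conjugatesOfSet_iff.mp hy
    obtain ⟨g, rfl⟩ := isConj_iff.mp hy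
    obtain ⟨d, hd⟩ := exists_mul_zpow_mem_commutator (k := 0) (by omega) g
    have hcomm : Commute (artin n 0 ^ d) (basicDiff n) :=
      Commute.zpow_left (((Commute.refl _).pow_right 2).mul_right
        (((artin_commute (show 0 + 2 ≤ 2 by omega)).pow_right 2).inv_right)) d
    have heq : g * basicDiff n * g⁻¹ =
        g * artin n 0 ^ d * basicDiff n * (g * artin n 0 ^ d)⁻¹ := by
      rw [mul_assoc g (artin n 0 ^ d), hcomm.eq]
      group
    have hk := (hμ.basicDiff_mem hn).2
    have := hμ.linking_map_conj hψ ⟨_, hd⟩ (x := basicDiff' n hn) hk s(k, l)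
    simp only [heq]
    rw [hμ.linking_conj _ hk, hμ.strandSum_conj _ hk, hμ.strandSum_conj _ hk]
    refine this.trans ?_
    rw [Sym2.map_mk]
    exact hαβ _ _ (fun h => hkl ((μ _)⁻¹.injective h))
  | one =>
    intro k l hkl
    have : (⟨1, hx⟩ : ↥(commutator (BraidGroup n))) = 1 := rfl
    rw [this, map_one]
    simp [strandSum, linking_one]
  | mul y z hy hz ihy ihz =>
    intro k l hkl
    have h1 := hle hy
    have hψy := (map_mem_Jsub_iff hψ (x := ⟨y, h1.1⟩)).mpr h1.2
    have h2 := hle hz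
    have : (⟨y * z, hx⟩ : ↥(commutator (BraidGroup n))) = ⟨y, h1.1⟩ * ⟨z, h2.1⟩ := rfl
    rw [this, map_mul, Subgroup.coe_mul, Subgroup.coe_mul,
      hμ.linking_mul_of_mem_ker (mem_Jsub.mp hψy),
      hμ.linking_mul_of_mem_ker h1.2, hμ.strandSum_mul h1.2, hμ.strandSum_mul h1.2,
      ihy h1.1 k l hkl, ihz h2.1 k l hkl]
    ring
  | inv y hy ih =>
    intro k l hkl
    have h1 := hle hy
    have hψy := (map_mem_Jsub_iff hψ (x := ⟨y, h1.1⟩)).mpr h1.2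
    have : (⟨y⁻¹, hx⟩ : ↥(commutator (BraidGroup n))) = ⟨y, h1.1⟩⁻¹ := rfl
    rw [this, map_inv, Subgroup.coe_inv, Subgroup.coe_inv,
      hμ.linking_inv_of_mem_ker (mem_Jsub.mp hψy),
      hμ.linking_inv_of_mem_ker h1.2, hμ.strandSum_inv h1.2, hμ.strandSum_inv h1.2,
      ih h1.1 k l hkl]
    ring

lemma IsStandardPerm.exists_linking_map_eq (hμ : IsStandardPerm μ) (hn : 5 ≤ n)
    (hψ : ∀ x : ↥(commutator (BraidGroup n)), μ ↑(ψ x) = μ ↑x)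
    (hψ' : ∀ x : ↥(commutator (BraidGroup n)), μ ↑(ψ⁻¹ x) = μ ↑x) :
    (∀ x ∈ Jsub n μ, ∀ p, linking (ψ x : BraidGroup n) p = linking (x : BraidGroup n) p) ∨
    (∀ x ∈ Jsub n μ, ∀ p, linking (ψ x : BraidGroup n) p = -linking (x : BraidGroup n) p) := by
  obtain ⟨α, β, h⟩ := hμ.exists_linking_map hn hψ
  obtain ⟨α', β', h'⟩ := hμ.exists_linking_map hn hψ'
  have hc : basicDiff' n hn ∈ Jsub n μ := (hμ.basicDiff_mem hn).2
  have hψc := (map_mem_Jsub_iff hψ).mpr hc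
  have hcoe : (basicDiff' n hn : BraidGroup n) = basicDiff n := rfl
  have hsum : ∀ k, strandSum (ψ (basicDiff' n hn) : BraidGroup n) k =
      (α + (n - 2) * β) * strandSum (basicDiff n) k := by
    intro k
    have htot : ∑ m, strandSum (basicDiff n) m = 0 := by
      simp only [hμ.strandSum_basicDiff hn, Finset.sum_sub_distrib]
      have aux : ∀ a b : Fin n, a ≠ b →
          ∑ m, (if m = a ∨ m = b then (2 : ℤ) else 0) = 4 := fun a b hab => by
        rw [← Finset.sum_filter, Finset.sum_const, Finset.filter_or,
          Finset.card_union_of_disjoint (by simpa [Finset.filter_eq'] using hab)]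
        simp [Finset.filter_eq']
      rw [aux _ _ (by simp), aux _ _ (by simp), sub_self]
    have hterm : ∀ m, linking (ψ (basicDiff' n hn) : BraidGroup n) s(k, m) =
        α * linking (basicDiff n) s(k, m) +
          β * (strandSum (basicDiff n) k + strandSum (basicDiff n) m) -
          (if m = k then 2 * β * strandSum (basicDiff n) k else 0) := by
      intro m
      by_cases hm : m = k
      · subst hm
        rw [hμ.linking_of_isDiag (by omega) (mem_Jsub.mp hψc) (by simp),
          hμ.linking_of_isDiag (by omega) (hμ.basicDiff_mem hn).2 (by simp), if_pos rfl]
        ring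
      · rw [if_neg hm, sub_zero]
        exact h _ hc k m (Ne.symm hm)
    rw [strandSum]
    simp only [hterm, Finset.sum_sub_distrib, Finset.sum_add_distrib, ← Finset.mul_sum, htot,
      Finset.sum_ite_eq', Finset.mem_univ, if_true, Finset.sum_const, Finset.card_univ,
      Fintype.card_fin, nsmul_eq_mul]
    change α * strandSum (basicDiff n) k + _ - _ = _
    ring
  have h01 : (⟨0, by omega⟩ : Fin n) ≠ ⟨1, by omega⟩ := by simp
  have h04 : (⟨0, by omega⟩ : Fin n) ≠ ⟨4, by omega⟩ := by simp
  have e1 := h' _ hψc _ _ h01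
  have e2 := h' _ hψc _ _ h04
  rw [h _ hc _ _ h01, hsum, hsum, MulAut.inv_apply_self, hcoe] at e1
  rw [h _ hc _ _ h04, hsum, hsum, MulAut.inv_apply_self, hcoe] at e2
  simp [hμ.linking_basicDiff hn, hμ.strandSum_basicDiff hn] at e1 e2
  have hn' : (5 : ℤ) ≤ n := by exact_mod_cast hn
  set N : ℤ := (n : ℤ) - 2 with hN
  have hαα : α' * α = 1 := by linarith
  have hzero : α' * β + β' * (α + N * β) = 0 := by linarith
  have hγγ : (α' + N * β') * (α + N * β) = 1 := by linear_combination hαα + N * hzero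
  have hβ : β = 0 := by
    have h1 := Int.isUnit_iff.mp (IsUnit.of_mul_eq_one_right _ hαα)
    have h2 := Int.isUnit_iff.mp (IsUnit.of_mul_eq_one_right _ hγγ)
    have h3 : |N * β| ≤ 2 := by
      rcases h1 with h1 | h1 <;> rcases h2 with h2 | h2 <;> rw [abs_le] <;>
        constructor <;> linarith
    by_contra hβ
    rw [abs_mul, abs_of_nonneg (by omega)] at h3
    nlinarith [Int.one_le_abs hβ]
  have hlink : ∀ x ∈ Jsub n μ, ∀ p,
      linking (ψ x : BraidGroup n) p = α * linking (x : BraidGroup n) p := by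
    intro x hx p
    induction p using Sym2.ind with
    | _ k l =>
      by_cases hkl : k = l
      · rw [hμ.linking_of_isDiag (by omega) (mem_Jsub.mp ((map_mem_Jsub_iff hψ).mpr hx))
          (by simpa using hkl), hμ.linking_of_isDiag (by omega) (mem_Jsub.mp hx)
          (by simpa using hkl), mul_zero]
      · rw [h x hx k l hkl, hβ, zero_mul, add_zero]
  rcases Int.isUnit_iff.mp (IsUnit.of_mul_eq_one_right _ hαα) with hα | hα
  · exact .inl fun x hx p => by rw [hlink x hx, hα, one_mul]
  · exact .inr fun x hx p => by rw [hlink x hx, hα, neg_one_mul]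

end Automorphism

/-- For `n ≥ 5` and an automorphism `φ` of `B'_n` with `μ' ∘ φ = μ'`, `φ` maps `J_n`
onto `J_n`, and the induced automorphism of the abelianization `J_n^{ab}` is `±id`:
either `φ(x)·x⁻¹ ∈ [J_n, J_n]` for all `x ∈ J_n`, or `φ(x)·x ∈ [J_n, J_n]`
for all `x ∈ J_n`. -/
theorem induced_aut_Jab_pm_id (n : ℕ) (hn : 5 ≤ n)
    (μ : BraidGroup n →* Equiv.Perm (Fin n))
    (hμ : ∀ i : Fin (n - 1), μ (σ i) =
      Equiv.swap ⟨(i : ℕ), by have := i.isLt; omega⟩ ⟨(i : ℕ) + 1, by have := i.isLt; omega⟩)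
    (φ : MulAut ↥(commutator (BraidGroup n)))
    (hφ : ∀ x : ↥(commutator (BraidGroup n)), μ ↑(φ x) = μ ↑x) :
    Subgroup.map φ.toMonoidHom (Jsub n μ) = Jsub n μ ∧
    ((∀ x ∈ Jsub n μ, φ x * x⁻¹ ∈ ⁅Jsub n μ, Jsub n μ⁆) ∨
     (∀ x ∈ Jsub n μ, φ x * x ∈ ⁅Jsub n μ, Jsub n μ⁆)) := by
  have hμ' : IsStandardPerm μ := fun i h => by
    rw [artin_of_lt (by omega)]
    exact hμ _
  have hφ' : ∀ x : ↥(commutator (BraidGroup n)), μ ↑(φ⁻¹ x) = μ ↑x := fun x => by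
    rw [← hφ (φ⁻¹ x), MulAut.apply_inv_self]
  refine ⟨map_Jsub hφ, ?_⟩
  have hlink := hμ'.exists_linking_map_eq hn hφ hφ'
  have hmem : ∀ {y}, y ∈ Jsub n μ → (∀ p, linking (y : BraidGroup n) p = 0) →
      y ∈ ⁅Jsub n μ, Jsub n μ⁆ := fun hy h =>
    mem_commutator_Jsub.mpr (hμ'.mem_commutator_of_linking_eq_zero hn hy h)
  refine hlink.imp (fun h x hx => ?_) (fun h x hx => ?_)
  all_goals
    have hφx := (map_mem_Jsub_iff hφ).mpr hx
  · refine hmem (mul_mem hφx (inv_mem hx)) fun p => ?_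
    rw [Subgroup.coe_mul, Subgroup.coe_inv, hμ'.linking_mul_of_mem_ker (mem_Jsub.mp hφx),
      hμ'.linking_inv_of_mem_ker (mem_Jsub.mp hx), h x hx, add_neg_cancel]
  · refine hmem (mul_mem hφx hx) fun p => ?_
    rw [Subgroup.coe_mul, hμ'.linking_mul_of_mem_ker (mem_Jsub.mp hφx), h x hx, neg_add_cancel]
end

section
/- For every n ≥ 2 and every pure braid β ∈ P_n, the following are equivalent: (i) β is periodic, i.e., there exists an integer k ≥ 1 such that β^k lies in the center of B_n; (ii) β is a power of the full twist, i.e., there exists an integer d with β = Δ^{2d}. -/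
/-- Garside's half twist `Δ_n = ∏_{i=1}^{n-1} ∏_{j=1}^{n-i} σ_j` (the factors multiplied
left-to-right, in 0-based indices). -/
def halfTwist (n : ℕ) : BraidGroup n :=
  ((List.finRange (n - 1)).map (fun i =>
    ((List.finRange (n - 1 - (i : ℕ))).map (fun j =>
      σ (Fin.castLE (Nat.sub_le _ _) j))).prod)).prod

namespace BraidGroup

/-- The elements `s 0, …, s (N - 1)` of a group satisfy the braid relations. -/
structure IsBraidSeq {G : Type*} [Group G] (s : ℕ → G) (N : ℕ) : Prop where
  comm : ∀ i j, i + 2 ≤ j → j < N → s i * s j = s j * s i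
  braid : ∀ i, i + 1 < N → s i * s (i + 1) * s i = s (i + 1) * s i * s (i + 1)

/-- The Artin generators indexed by `ℕ`, with value `1` outside the range of indices. -/
def gen (n i : ℕ) : BraidGroup n := if h : i < n - 1 then σ ⟨i, h⟩ else 1

theorem gen_eq {n i : ℕ} (h : i < n - 1) : gen n i = σ ⟨i, h⟩ := dif_pos h

theorem isBraidSeq_gen (n : ℕ) : IsBraidSeq (gen n) (n - 1) where
  comm i j hij hj := by
    have hi : i < n - 1 := by omega
    rw [gen_eq hi, gen_eq hj]
    have h := PresentedGroup.one_of_mem (rels := braidRels n)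
      (Or.inl ⟨⟨i, hi⟩, ⟨j, hj⟩, hij, rfl⟩)
    simp only [map_mul, map_inv] at h
    exact mul_inv_eq_iff_eq_mul.mp (mul_inv_eq_one.mp h)
  braid i hi := by
    have hi' : i < n - 1 := by omega
    rw [gen_eq hi, gen_eq hi']
    have h := PresentedGroup.one_of_mem (rels := braidRels n)
      (Or.inr ⟨⟨i, hi'⟩, ⟨i + 1, hi⟩, rfl, rfl⟩)
    simp only [map_mul, map_inv] at h
    rw [mul_inv_eq_one] at h
    exact h

section Lift

variable {G : Type*} [Group G] {n : ℕ}

/-- The homomorphism from the braid group determined by a sequence satisfying the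
braid relations. -/
def lift {s : ℕ → G} (h : IsBraidSeq s (n - 1)) : BraidGroup n →* G :=
  PresentedGroup.toGroup (f := fun i : Fin (n - 1) => s i) (by
    rintro r (⟨i, j, hij, rfl⟩ | ⟨i, j, hij, rfl⟩)
    · simp only [map_mul, map_inv, FreeGroup.lift_apply_of]
      rw [mul_inv_eq_one, mul_inv_eq_iff_eq_mul]
      exact h.comm i j hij j.isLt
    · simp only [map_mul, map_inv, FreeGroup.lift_apply_of]
      rw [mul_inv_eq_one, hij]
      exact h.braid i (hij ▸ j.isLt))

theorem lift_gen {s : ℕ → G} (h : IsBraidSeq s (n - 1)) {i : ℕ} (hi : i < n - 1) :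
    lift h (gen n i) = s i := by
  rw [gen_eq hi]
  exact PresentedGroup.toGroup.of _

theorem hom_ext {f g : BraidGroup n →* G}
    (h : ∀ i, i < n - 1 → f (gen n i) = g (gen n i)) : f = g := by
  apply PresentedGroup.ext
  intro i
  have := h i i.isLt
  rwa [gen_eq i.isLt] at this

end Lift

theorem induction_on {n : ℕ} {p : BraidGroup n → Prop} (β : BraidGroup n) (one : p 1)
    (gen : ∀ i, i < n - 1 → p (gen n i)) (mul : ∀ x y, p x → p y → p (x * y))
    (inv : ∀ x, p x → p x⁻¹) : p β := by
  have hβ : β ∈ Subgroup.closure (Set.range (PresentedGroup.of (rels := braidRels n))) := by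
    rw [PresentedGroup.closure_range_of]; trivial
  induction hβ using Subgroup.closure_induction with
  | mem x hx =>
    obtain ⟨i, rfl⟩ := hx
    have := gen i i.isLt
    rwa [gen_eq i.isLt] at this
  | one => exact one
  | mul x y _ _ hx hy => exact mul x y hx hy
  | inv x _ hx => exact inv x hx

theorem mem_center_of_gen {n : ℕ} {z : BraidGroup n}
    (h : ∀ i, i < n - 1 → gen n i * z = z * gen n i) : z ∈ Subgroup.center (BraidGroup n) := by
  rw [Subgroup.mem_center_iff]
  intro β
  change Commute β z
  induction β using induction_on with
  | one => exact Commute.one_left z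
  | gen i hi => exact h i hi
  | mul x y hx hy => exact hx.mul_left hy
  | inv x hx => exact hx.inv_left

section Permutation

theorem isBraidSeq_swap (N : ℕ) : IsBraidSeq (fun i : ℕ => Equiv.swap i (i + 1)) N where
  comm i j hij _ := by
    ext k
    simp only [Equiv.Perm.mul_apply, Equiv.swap_apply_def]
    split_ifs <;> omega
  braid i _ := by
    ext k
    simp only [Equiv.Perm.mul_apply, Equiv.swap_apply_def]
    split_ifs <;> omega

/-- The permutation of a braid, extended to `ℕ` by the identity. -/
def perm (n : ℕ) : BraidGroup n →* Equiv.Perm ℕ := lift (isBraidSeq_swap (n - 1))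

theorem perm_gen {n i : ℕ} (hi : i < n - 1) : perm n (gen n i) = Equiv.swap i (i + 1) :=
  lift_gen _ hi

theorem perm_eq_one_of_mem_ker {n : ℕ} (μ : BraidGroup n →* Equiv.Perm (Fin n))
    (hμ : ∀ i : Fin (n - 1), μ (σ i) =
      Equiv.swap ⟨(i : ℕ), by have := i.isLt; omega⟩ ⟨(i : ℕ) + 1, by have := i.isLt; omega⟩)
    {β : BraidGroup n} (hβ : β ∈ μ.ker) : perm n β = 1 := by
  have h : perm n = (Equiv.Perm.viaEmbeddingHom Fin.valEmbedding).comp μ := by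
    apply hom_ext
    intro i hi
    rw [perm_gen hi, gen_eq hi, MonoidHom.comp_apply, hμ]
    ext k
    rw [Equiv.Perm.viaEmbeddingHom_apply]
    by_cases hk : k < n
    · have := Equiv.Perm.viaEmbedding_apply
        (Equiv.swap (⟨i, by omega⟩ : Fin n) ⟨i + 1, by omega⟩) Fin.valEmbedding ⟨k, hk⟩
      simp only [Fin.valEmbedding_apply] at this
      rw [this]
      simp only [Equiv.swap_apply_def, Fin.mk.injEq]
      split_ifs <;> rfl
    · rw [Equiv.Perm.viaEmbedding_apply_of_notMem]
      · rw [Equiv.swap_apply_of_ne_of_ne] <;> omega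
      · rintro ⟨j, rfl⟩
        exact hk j.isLt
  rw [h, MonoidHom.comp_apply, MonoidHom.mem_ker.mp hβ, map_one]

end Permutation

section HalfTwist

variable {G : Type*} [Group G]

/-- The product `s j * s (j + 1) * ⋯ * s (j + l - 1)`. -/
def run (s : ℕ → G) (j l : ℕ) : G := ((List.range l).map fun t => s (j + t)).prod

/-- The product `s (l - 1) * ⋯ * s 1 * s 0`. -/
def revRun (s : ℕ → G) : ℕ → G
  | 0 => 1
  | l + 1 => s l * revRun s l

/-- The Garside half-twist of a sequence: `run s 0 (n - 1) * ⋯ * run s 0 1`. -/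
def garside (s : ℕ → G) : ℕ → G
  | 0 => 1
  | m + 1 => run s 0 m * garside s m

@[simp] theorem run_zero (s : ℕ → G) (j : ℕ) : run s j 0 = 1 := rfl

theorem run_succ (s : ℕ → G) (j l : ℕ) : run s j (l + 1) = run s j l * s (j + l) := by
  simp [run, List.range_succ]

theorem run_succ' (s : ℕ → G) (j l : ℕ) : run s j (l + 1) = s j * run s (j + 1) l := by
  simp [run, List.range_succ_eq_map, Function.comp_def, add_assoc, add_comm 1]

theorem map_run {H : Type*} [Group H] (f : G →* H) {s : ℕ → G} {t : ℕ → H} (j l : ℕ)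
    (h : ∀ i, i < j + l → f (s i) = t i) : f (run s j l) = run t j l := by
  induction l with
  | zero => simp
  | succ l ih =>
    rw [run_succ, run_succ, map_mul, ih fun i hi => h i (by omega), h _ (by omega)]

theorem map_garside {H : Type*} [Group H] (f : G →* H) {s : ℕ → G} {t : ℕ → H} (n : ℕ)
    (h : ∀ i, i < n - 1 → f (s i) = t i) : f (garside s n) = garside t n := by
  induction n with
  | zero => simp [garside]
  | succ n ih =>
    rw [garside, garside, map_mul, ih fun i hi => h i (by omega),
      map_run f (t := t) 0 n fun i hi => h i (by omega)]

theorem halfTwist_eq_garside (n : ℕ) : halfTwist n = garside (gen n) n := by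
  have key : ∀ m, m ≤ n - 1 → garside (gen n) (m + 1) =
      ((List.range m).map fun i => run (gen n) 0 (m - i)).prod := by
    intro m
    induction m with
    | zero => intro _; simp [garside]
    | succ m ih =>
      intro hm
      rw [garside, ih (by omega), List.range_succ_eq_map]
      simp [Function.comp_def]
  rcases n with _ | n
  · simp [halfTwist, garside]
  have hlist : (do let a ← List.finRange n; pure (a : ℕ)) = List.range n := by
    rw [← List.map_coe_finRange_eq_range, List.map_eq_flatMap]
    rfl
  rw [key n (by simp), halfTwist]
  change (List.map _ (do let a ← List.finRange n; pure (a : ℕ))).prod = _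
  rw [hlist]
  congr 1
  apply List.map_congr_left
  intro i _
  rw [run, ← List.map_coe_finRange_eq_range, List.map_map]
  congr 1
  apply List.map_congr_left
  intro j _
  rw [Function.comp_apply, zero_add, gen_eq (by have := j.isLt; omega)]
  rfl

variable {s : ℕ → G} {N : ℕ}

theorem IsBraidSeq.commute_run_of_lt (h : IsBraidSeq s N) {i j l : ℕ} (hij : i + 1 < j)
    (hl : j + l ≤ N) : s i * run s j l = run s j l * s i := by
  induction l with
  | zero => simp
  | succ l ih =>
    rw [run_succ, ← mul_assoc, ih (by omega), mul_assoc, mul_assoc,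
      h.comm i (j + l) (by omega) (by omega)]

theorem IsBraidSeq.commute_run_of_gt (h : IsBraidSeq s N) {i j l : ℕ} (hij : j + l + 1 ≤ i)
    (hi : i < N) : s i * run s j l = run s j l * s i := by
  induction l with
  | zero => simp
  | succ l ih =>
    rw [run_succ, ← mul_assoc, ih (by omega), mul_assoc, mul_assoc,
      h.comm (j + l) i (by omega) (by omega)]

theorem IsBraidSeq.succ_mul_run (h : IsBraidSeq s N) {i j l : ℕ} (hj : j ≤ i)
    (hi : i + 1 < j + l) (hl : j + l ≤ N) : s (i + 1) * run s j l = run s j l * s i := by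
  induction l with
  | zero => omega
  | succ l ih =>
    rw [run_succ]
    rcases Nat.lt_or_ge (i + 1) (j + l) with hlt | hge
    · rw [← mul_assoc, ih hlt (by omega), mul_assoc, mul_assoc,
        h.comm i (j + l) (by omega) (by omega)]
    · obtain ⟨l, rfl⟩ : ∃ l', l = l' + 1 := ⟨l - 1, by omega⟩
      obtain rfl : i = j + l := by omega
      have hb := h.braid (j + l) (by omega)
      rw [run_succ, ← add_assoc, ← mul_assoc, ← mul_assoc,
        h.commute_run_of_gt (by omega) (by omega), mul_assoc (run s j l), mul_assoc (run s j l),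
        ← hb]
      simp only [mul_assoc]

theorem IsBraidSeq.commute_revRun (h : IsBraidSeq s N) {i l : ℕ} (hij : l + 1 ≤ i)
    (hi : i < N) : revRun s l * s i = s i * revRun s l := by
  induction l with
  | zero => simp [revRun]
  | succ l ih =>
    rw [revRun, mul_assoc, ih (by omega), ← mul_assoc, ← mul_assoc,
      h.comm l i (by omega) (by omega)]

theorem IsBraidSeq.revRun_mul_succ (h : IsBraidSeq s N) {i l : ℕ}
    (hi : i + 1 < l) (hl : l ≤ N) : revRun s l * s (i + 1) = s i * revRun s l := by
  induction l with
  | zero => omega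
  | succ l ih =>
    rw [revRun]
    rcases Nat.lt_or_ge (i + 1) l with hlt | hge
    · rw [mul_assoc, ih hlt (by omega), ← mul_assoc, ← mul_assoc,
        h.comm i l (by omega) (by omega)]
    · obtain rfl : l = i + 1 := by omega
      have hb := h.braid i (by omega)
      rw [revRun, mul_assoc, mul_assoc, h.commute_revRun (by omega) (by omega)]
      simp only [← mul_assoc]
      rw [hb]

theorem IsBraidSeq.commute_garside (h : IsBraidSeq s N) {m : ℕ} {i : ℕ} (hm : m ≤ i)
    (hi : i < N) : s i * garside s m = garside s m * s i := by
  induction m with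
  | zero => simp [garside]
  | succ m ih =>
    rw [garside, ← mul_assoc, h.commute_run_of_gt (by omega) hi, mul_assoc, ih (by omega),
      mul_assoc]

theorem IsBraidSeq.garside_succ' (h : IsBraidSeq s N) {m : ℕ} (hm : m ≤ N) :
    garside s (m + 1) = garside s m * revRun s m := by
  induction m with
  | zero => simp [garside, revRun]
  | succ m ih =>
    rw [garside, run_succ, zero_add, mul_assoc, ih (by omega), ← mul_assoc (s m),
      h.commute_garside le_rfl (by omega), mul_assoc, ← mul_assoc, ← garside, ← revRun,
      ih (by omega)]

theorem IsBraidSeq.garside_mul (h : IsBraidSeq s N) {m i : ℕ} (hi : i + 1 < m) (hm : m ≤ N + 1) :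
    garside s m * s i = s (m - 2 - i) * garside s m := by
  induction m generalizing i with
  | zero => omega
  | succ m ih =>
    rcases Nat.lt_or_ge (i + 1) m with hlt | hge
    · rw [garside, mul_assoc, ih hlt (by omega), ← mul_assoc,
        ← h.succ_mul_run (by omega) (by omega) (by omega), mul_assoc]
      congr 2
      omega
    · obtain rfl : m = i + 1 := by omega
      rcases i with _ | i
      · simp [garside, run]
      · rw [h.garside_succ' (by omega), mul_assoc, h.revRun_mul_succ (by omega) (by omega),
          ← mul_assoc, ih (by omega) (by omega), mul_assoc]
        congr 2
        omega

theorem IsBraidSeq.commute_garside_sq (h : IsBraidSeq s N) {m i : ℕ} (hi : i + 1 < m)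
    (hm : m ≤ N + 1) : s i * garside s m ^ 2 = garside s m ^ 2 * s i := by
  rw [pow_two, mul_assoc (garside s m), h.garside_mul hi hm, ← mul_assoc (garside s m),
    h.garside_mul (by omega) hm, mul_assoc]
  congr 2
  omega

end HalfTwist

theorem garside_sq_mem_center (n : ℕ) :
    garside (gen n) n ^ 2 ∈ Subgroup.center (BraidGroup n) :=
  mem_center_of_gen fun _ hi => (isBraidSeq_gen n).commute_garside_sq (by omega) (by omega)

section FreeGroup

theorem _root_.FreeGroup.exists_toWord_eq_cons_of_commute {α : Type*} [DecidableEq α]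
    {w : FreeGroup α} (hw : w ≠ 1) {a : α} (h : Commute w (FreeGroup.of a)) :
    ∃ e L, w.toWord = (a, e) :: L := by
  rcases hL : w.toWord with _ | ⟨⟨b, e⟩, L⟩
  · exact absurd (FreeGroup.toWord_eq_nil_iff.mp hL) hw
  by_cases hab : a = b
  · exact ⟨e, L, by rw [hab]⟩
  exfalso
  have hred : FreeGroup.IsReduced ((a, true) :: (b, e) :: L) := by
    rw [FreeGroup.isReduced_cons_cons, ← hL]
    exact ⟨fun h => absurd h hab, FreeGroup.isReduced_toWord⟩
  have h₁ : (FreeGroup.of a * w).toWord = (a, true) :: (b, e) :: L := by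
    rw [FreeGroup.toWord_mul, FreeGroup.toWord_of, hL]
    exact hred.reduce_eq
  have h₂ := FreeGroup.toWord_mul_sublist w (FreeGroup.of a)
  rw [h.eq, h₁, hL, FreeGroup.toWord_of] at h₂
  have h₃ := h₂.eq_of_length (by simp)
  simp only [List.cons_append, List.cons.injEq, Prod.mk.injEq] at h₃
  exact hab h₃.1.1

theorem _root_.FreeGroup.eq_one_of_commute_of {α : Type*} {w : FreeGroup α} {a b : α}
    (hab : a ≠ b) (ha : Commute w (FreeGroup.of a)) (hb : Commute w (FreeGroup.of b)) :
    w = 1 := by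
  classical
  by_contra hw
  obtain ⟨e, L, h₁⟩ := FreeGroup.exists_toWord_eq_cons_of_commute hw ha
  obtain ⟨e', L', h₂⟩ := FreeGroup.exists_toWord_eq_cons_of_commute hw hb
  rw [h₁] at h₂
  simp only [List.cons.injEq, Prod.mk.injEq] at h₂
  exact hab h₂.1.1

end FreeGroup

section Artin

open FreeGroup (of)

/-- Artin's automorphism of the free group attached to the `i`-th generator. -/
def artinAut (i : ℕ) : MulAut (FreeGroup ℕ) :=
  MonoidHom.toMulEquiv
    (FreeGroup.lift fun j =>
      if j = i then (of i)⁻¹ * of (i + 1) * of i else if j = i + 1 then of i else of j)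
    (FreeGroup.lift fun j =>
      if j = i then of (i + 1) else if j = i + 1 then of (i + 1) * of i * (of (i + 1))⁻¹ else of j)
    (by
      ext j
      by_cases h₁ : j = i
      · simp [h₁]
        group
      by_cases h₂ : j = i + 1
      · simp [h₂]
      · simp [h₁, h₂])
    (by
      ext j
      by_cases h₁ : j = i
      · simp [h₁]
      by_cases h₂ : j = i + 1
      · simp [h₂]
        group
      · simp [h₁, h₂])

theorem artinAut_self (i : ℕ) : artinAut i (of i) = (of i)⁻¹ * of (i + 1) * of i := by
  simp [artinAut]

theorem artinAut_succ (i : ℕ) : artinAut i (of (i + 1)) = of i := by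
  simp [artinAut]

theorem artinAut_of_ne {i j : ℕ} (h₁ : j ≠ i) (h₂ : j ≠ i + 1) : artinAut i (of j) = of j := by
  simp [artinAut, h₁, h₂]

theorem isBraidSeq_artinAut (N : ℕ) : IsBraidSeq artinAut N where
  comm i j hij _ := by
    apply MulEquiv.toMonoidHom_injective
    ext k
    change artinAut i (artinAut j (of k)) = artinAut j (artinAut i (of k))
    rcases eq_or_ne k i with rfl | h₁
    · simp (disch := omega) only [map_mul, map_inv, artinAut_self, artinAut_of_ne]
    rcases eq_or_ne k (i + 1) with rfl | h₂
    · simp (disch := omega) only [artinAut_succ, artinAut_of_ne]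
    rcases eq_or_ne k j with rfl | h₃
    · simp (disch := omega) only [map_mul, map_inv, artinAut_self, artinAut_of_ne]
    rcases eq_or_ne k (j + 1) with rfl | h₄
    · simp (disch := omega) only [artinAut_succ, artinAut_of_ne]
    · simp (disch := omega) only [artinAut_of_ne]
  braid i _ := by
    apply MulEquiv.toMonoidHom_injective
    ext k
    change artinAut i (artinAut (i + 1) (artinAut i (of k))) =
      artinAut (i + 1) (artinAut i (artinAut (i + 1) (of k)))
    rcases eq_or_ne k i with rfl | h₁
    · simp (disch := omega) only [map_mul, map_inv, artinAut_self, artinAut_succ, artinAut_of_ne]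
      group
    rcases eq_or_ne k (i + 1) with rfl | h₂
    · simp (disch := omega) only [map_mul, map_inv, artinAut_self, artinAut_succ, artinAut_of_ne]
    rcases eq_or_ne k (i + 2) with rfl | h₃
    · have h := artinAut_succ (i + 1)
      rw [show i + 1 + 1 = i + 2 from rfl] at h
      simp (disch := omega) only [h, artinAut_succ, artinAut_of_ne]
    · simp (disch := omega) only [artinAut_of_ne]

/-- The Artin representation. -/
def artin (m : ℕ) : BraidGroup m →* MulAut (FreeGroup ℕ) := lift (isBraidSeq_artinAut (m - 1))

theorem artin_gen {m i : ℕ} (hi : i < m - 1) : artin m (gen m i) = artinAut i := lift_gen _ hi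

/-- The elements `s i` satisfy the braid relations on `m` strings, and they act on the elements
`x j` by conjugation as in the Artin representation. -/
structure IsArtinPair {G : Type*} [Group G] (s x : ℕ → G) (m : ℕ) : Prop where
  isBraidSeq : IsBraidSeq s (m - 1)
  succ : ∀ i, i + 1 < m → s i * x (i + 1) = x i * s i
  mul : ∀ i, i + 1 < m → s i * (x (i + 1) * x i) = x (i + 1) * x i * s i
  far : ∀ i j, i + 1 < m → j ≠ i → j ≠ i + 1 → s i * x j = x j * s i

/-- The semidirect product of a free group and the braid group on `m` strings along the Artin
representation. -/
abbrev ArtinProduct (m : ℕ) := FreeGroup ℕ ⋊[artin m] BraidGroup m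

theorem inr_mul_inl {m : ℕ} (b : BraidGroup m) (f : FreeGroup ℕ) :
    (SemidirectProduct.inr b * SemidirectProduct.inl f : ArtinProduct m) =
      SemidirectProduct.inl (artin m b f) * SemidirectProduct.inr b := by
  rw [SemidirectProduct.inl_aut, map_inv, inv_mul_cancel_right]

theorem isArtinPair_artinProduct (m : ℕ) :
    IsArtinPair (fun i => (SemidirectProduct.inr (gen m i) : ArtinProduct m))
      (fun j => SemidirectProduct.inl (of j)) m where
  isBraidSeq :=
    { comm := fun i j hij hj => by
        rw [← map_mul, ← map_mul, (isBraidSeq_gen m).comm i j hij hj]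
      braid := fun i hi => by
        simp only [← map_mul, (isBraidSeq_gen m).braid i hi] }
  succ i hi := by
    rw [inr_mul_inl, artin_gen (by omega), artinAut_succ]
  mul i hi := by
    rw [← map_mul, inr_mul_inl, artin_gen (by omega), map_mul, artinAut_succ, artinAut_self]
    congr 2
    group
  far i j hi h₁ h₂ := by
    rw [inr_mul_inl, artin_gen (by omega), artinAut_of_ne h₁ h₂]

/-- The homomorphism from the semidirect product determined by an Artin pair. -/
def IsArtinPair.lift {G : Type*} [Group G] {s x : ℕ → G} {m : ℕ} (h : IsArtinPair s x m) :
    ArtinProduct m →* G :=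
  SemidirectProduct.lift (FreeGroup.lift x) (BraidGroup.lift h.isBraidSeq) (by
    intro b
    have key : ∀ f, FreeGroup.lift x (artin m b f) = BraidGroup.lift h.isBraidSeq b *
        FreeGroup.lift x f * (BraidGroup.lift h.isBraidSeq b)⁻¹ := by
      induction b using induction_on with
      | one => simp
      | gen i hi =>
        have : (FreeGroup.lift x).comp (artinAut i).toMonoidHom =
            (MulAut.conj (s i)).toMonoidHom.comp (FreeGroup.lift x) := by
          ext j
          change FreeGroup.lift x (artinAut i (of j)) =
            s i * FreeGroup.lift x (of j) * (s i)⁻¹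
          have hs := h.succ i (by omega)
          rcases eq_or_ne j i with rfl | h₁
          · have hm := h.mul j (by omega)
            rw [← mul_assoc, hs, mul_assoc, mul_assoc] at hm
            simp only [artinAut_self, map_mul, map_inv, FreeGroup.lift_apply_of]
            rw [eq_mul_inv_iff_mul_eq, mul_assoc, mul_assoc, inv_mul_eq_iff_eq_mul, hm]
          rcases eq_or_ne j (i + 1) with rfl | h₂
          · simp only [artinAut_succ, FreeGroup.lift_apply_of]
            rw [hs, mul_inv_cancel_right]
          · simp only [artinAut_of_ne h₁ h₂, FreeGroup.lift_apply_of]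
            rw [h.far i j (by omega) h₁ h₂, mul_inv_cancel_right]
        intro f
        rw [artin_gen hi, lift_gen _ hi]
        exact DFunLike.congr_fun this f
      | mul a b ha hb =>
        intro f
        rw [map_mul, MulAut.mul_apply, ha, hb, map_mul]
        group
      | inv a ha =>
        intro f
        have := ha (artin m a⁻¹ f)
        rw [map_inv, MulAut.apply_inv_self] at this
        rw [this, map_inv, map_inv]
        group
    ext j
    simpa using key (of j))

theorem IsArtinPair.lift_inl {G : Type*} [Group G] {s x : ℕ → G} {m : ℕ}
    (h : IsArtinPair s x m) (j : ℕ) : h.lift (SemidirectProduct.inl (of j)) = x j := by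
  rw [IsArtinPair.lift, SemidirectProduct.lift_inl, FreeGroup.lift_apply_of]

theorem IsArtinPair.lift_inr {G : Type*} [Group G] {s x : ℕ → G} {m : ℕ}
    (h : IsArtinPair s x m) {i : ℕ} (hi : i < m - 1) :
    h.lift (SemidirectProduct.inr (gen m i)) = s i := by
  rw [IsArtinPair.lift, SemidirectProduct.lift_inr, lift_gen _ hi]

end Artin

section Loop

variable {G : Type*} [Group G]

/-- The pure braid in which strand `j` winds once around the last strand. -/
def loop (s : ℕ → G) (m j : ℕ) : G :=
  if j < m then (run s (j + 1) (m - (j + 1)))⁻¹ * s j ^ 2 * run s (j + 1) (m - (j + 1)) else 1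

theorem loop_eq {s : ℕ → G} {m j : ℕ} (hj : j < m) :
    loop s m j = (run s (j + 1) (m - (j + 1)))⁻¹ * s j ^ 2 * run s (j + 1) (m - (j + 1)) :=
  if_pos hj

theorem mul_run_succ (s : ℕ → G) {m j : ℕ} (hj : j < m) :
    s j * run s (j + 1) (m - (j + 1)) = run s j (m - j) := by
  rw [← run_succ']
  congr 1
  omega

theorem IsBraidSeq.mul_loop_succ {s : ℕ → G} {m : ℕ} (h : IsBraidSeq s m) {i : ℕ}
    (hi : i + 1 < m) : s i * loop s m (i + 1) = loop s m i * s i := by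
  rw [loop_eq hi, loop_eq (by omega), ← mul_run_succ s hi]
  have hr := h.commute_run_of_lt (i := i) (j := i + 1 + 1) (l := m - (i + 1 + 1))
    (by omega) (by omega)
  set r := run s (i + 1 + 1) (m - (i + 1 + 1))
  have hb := h.braid i hi
  generalize s (i + 1) = b at *
  generalize s i = a at *
  have hr' : a * r⁻¹ = r⁻¹ * a := by
    rw [eq_inv_mul_iff_mul_eq, ← mul_assoc, ← hr, mul_inv_cancel_right]
  have key : b * a * b ^ 2 = a ^ 2 * b * a := by
    calc b * a * b ^ 2 = (b * a * b) * b := by simp only [pow_two, mul_assoc]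
      _ = a * (b * a * b) := by rw [← hb]; simp only [mul_assoc, ← hb]
      _ = a ^ 2 * b * a := by rw [← hb]; simp only [pow_two, mul_assoc]
  calc a * (r⁻¹ * b ^ 2 * r) = a * r⁻¹ * b ^ 2 * r := by simp only [mul_assoc]
    _ = r⁻¹ * b⁻¹ * (b * a * b ^ 2) * r := by rw [hr']; group
    _ = r⁻¹ * b⁻¹ * a ^ 2 * b * (a * r) := by rw [key]; simp only [mul_assoc]
    _ = (b * r)⁻¹ * a ^ 2 * (b * r) * a := by rw [hr, mul_inv_rev]; simp only [mul_assoc]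

theorem IsBraidSeq.mul_loop_mul_loop {s : ℕ → G} {m : ℕ} (h : IsBraidSeq s m) {i : ℕ}
    (hi : i + 1 < m) : s i * (loop s m (i + 1) * loop s m i) =
      loop s m (i + 1) * loop s m i * s i := by
  rw [loop_eq hi, loop_eq (by omega), ← mul_run_succ s hi]
  have hr := h.commute_run_of_lt (i := i) (j := i + 1 + 1) (l := m - (i + 1 + 1))
    (by omega) (by omega)
  set r := run s (i + 1 + 1) (m - (i + 1 + 1))
  have hb := h.braid i hi
  generalize s (i + 1) = b at *
  generalize s i = a at *
  have hr' : a * r⁻¹ = r⁻¹ * a := by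
    rw [eq_inv_mul_iff_mul_eq, ← mul_assoc, ← hr, mul_inv_cancel_right]
  have key : a * (b * a * a * b) = b * a * a * b * a := by
    calc a * (b * a * a * b) = a * b * a * a * b := by simp only [mul_assoc]
      _ = b * a * (b * a * b) := by rw [hb]; simp only [mul_assoc]
      _ = b * a * a * b * a := by rw [← hb]; simp only [mul_assoc]
  have heq : r⁻¹ * b ^ 2 * r * ((b * r)⁻¹ * a ^ 2 * (b * r)) = r⁻¹ * (b * a * a * b) * r := by
    simp [pow_two, mul_assoc]
  rw [heq]
  calc a * (r⁻¹ * (b * a * a * b) * r) = a * r⁻¹ * (b * a * a * b) * r := by simp only [mul_assoc]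
    _ = r⁻¹ * (a * (b * a * a * b)) * r := by rw [hr']; simp only [mul_assoc]
    _ = r⁻¹ * (b * a * a * b) * (a * r) := by rw [key]; simp only [mul_assoc]
    _ = r⁻¹ * (b * a * a * b) * r * a := by rw [hr]; simp only [mul_assoc]

theorem IsBraidSeq.commute_loop {s : ℕ → G} {m : ℕ} (h : IsBraidSeq s m) {i j : ℕ}
    (hi : i + 1 < m) (h₁ : j ≠ i) (h₂ : j ≠ i + 1) : s i * loop s m j = loop s m j * s i := by
  rcases Nat.lt_or_ge j m with hj | hj
  · rw [loop_eq hj]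
    change Commute (s i) _
    rcases Nat.lt_or_ge j i with hlt | hge
    · have hr := h.succ_mul_run (i := i) (j := j + 1) (l := m - (j + 1))
        (by omega) (by omega) (by omega)
      have hc : s (i + 1) * s j ^ 2 = s j ^ 2 * s (i + 1) :=
        (Commute.pow_left (h.comm j (i + 1) (by omega) hi) 2).symm
      set r := run s (j + 1) (m - (j + 1))
      have hs : s i = r⁻¹ * s (i + 1) * r := by rw [mul_assoc, hr, inv_mul_cancel_left]
      rw [hs]
      change r⁻¹ * s (i + 1) * r * (r⁻¹ * s j ^ 2 * r) =
        r⁻¹ * s j ^ 2 * r * (r⁻¹ * s (i + 1) * r)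
      calc _ = r⁻¹ * (s (i + 1) * s j ^ 2) * r := by group
        _ = _ := by rw [hc]; group
    · have hr : Commute (s i) (run s (j + 1) (m - (j + 1))) :=
        h.commute_run_of_lt (by omega) (by omega)
      have hc : Commute (s i) (s j) := h.comm i j (by omega) hj
      exact (hr.inv_right.mul_right (hc.pow_right 2)).mul_right hr
  · rw [loop, if_neg (by omega), mul_one, one_mul]

theorem IsBraidSeq.isArtinPair_loop {s : ℕ → G} {m : ℕ} (h : IsBraidSeq s m) :
    IsArtinPair s (loop s m) m where
  isBraidSeq := ⟨fun i j hij hj => h.comm i j hij (by omega), fun i hi => h.braid i (by omega)⟩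
  succ _ hi := h.mul_loop_succ hi
  mul _ hi := h.mul_loop_mul_loop hi
  far _ _ hi h₁ h₂ := h.commute_loop hi h₁ h₂

end Loop

section Step

variable {G : Type*} [Group G]

/-- The permutation of `ℕ × G` by which the `i`-th generator of the braid group on `m + 1`
strings acts on pairs (position of the last strand, element of the combing group). -/
def step (s x : ℕ → G) (m i : ℕ) : Equiv.Perm (ℕ × G) where
  toFun p :=
    if p.1 = i then (i + 1, x i * p.2) else if p.1 = i + 1 then (i, p.2)
    else if p.1 < i then (p.1, s (i - 1) * p.2) else if p.1 ≤ m then (p.1, s i * p.2) else p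
  invFun p :=
    if p.1 = i then (i + 1, p.2) else if p.1 = i + 1 then (i, (x i)⁻¹ * p.2)
    else if p.1 < i then (p.1, (s (i - 1))⁻¹ * p.2)
    else if p.1 ≤ m then (p.1, (s i)⁻¹ * p.2) else p
  left_inv := by
    rintro ⟨j, g⟩
    dsimp only
    split_ifs <;> simp_all
  right_inv := by
    rintro ⟨j, g⟩
    dsimp only
    split_ifs <;> simp_all

variable {s x : ℕ → G} {m : ℕ}

theorem step_self (i : ℕ) (g : G) : step s x m i (i, g) = (i + 1, x i * g) := by
  simp [step]

theorem step_succ (i : ℕ) (g : G) : step s x m i (i + 1, g) = (i, g) := by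
  simp [step]

theorem step_of_lt {i j : ℕ} (g : G) (h : j ≤ i) :
    step s x m (i + 1) (j, g) = (j, s i * g) := by
  simp [step, show j ≠ i + 1 by omega, show j ≠ i + 1 + 1 by omega, not_lt.mpr h]

theorem step_of_gt {i j : ℕ} (g : G) (h : i + 1 < j) (hj : j ≤ m) :
    step s x m i (j, g) = (j, s i * g) := by
  simp [step, show j ≠ i by omega, show j ≠ i + 1 by omega, show ¬ j < i by omega, hj]

theorem step_of_gt_top {i j : ℕ} (g : G) (hi : i < m) (hj : m < j) :
    step s x m i (j, g) = (j, g) := by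
  simp [step, show j ≠ i by omega, show j ≠ i + 1 by omega, show ¬ j < i by omega,
    show ¬ j ≤ m by omega]

theorem IsArtinPair.isBraidSeq_step (h : IsArtinPair s x m) : IsBraidSeq (step s x m) m where
  comm i l hil hl := by
    ext1 ⟨j, g⟩
    simp only [Equiv.Perm.mul_apply]
    obtain ⟨l, rfl⟩ : ∃ l', l = l' + 1 := ⟨l - 1, by omega⟩
    rcases Nat.lt_or_ge m j with hmj | hmj
    · simp (disch := omega) only [step_of_gt_top]
    rcases Nat.lt_or_ge j i with h₁ | h₁
    · obtain ⟨i, rfl⟩ : ∃ i', i = i' + 1 := ⟨i - 1, by omega⟩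
      simp (disch := omega) only [step_of_lt, ← mul_assoc]
      rw [h.isBraidSeq.comm i l (by omega) (by omega)]
    rcases eq_or_ne j i with rfl | h₂
    · simp (disch := omega) only [step_of_lt, step_self, ← mul_assoc]
      rw [h.far l j (by omega) (by omega) (by omega)]
    rcases eq_or_ne j (i + 1) with rfl | h₃
    · simp (disch := omega) only [step_of_lt, step_succ]
    rcases Nat.lt_or_ge j (l + 1) with h₄ | h₄
    · simp (disch := omega) only [step_of_lt, step_of_gt, ← mul_assoc]
      rw [h.isBraidSeq.comm i l (by omega) (by omega)]
    rcases eq_or_ne j (l + 1) with rfl | h₅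
    · simp (disch := omega) only [step_self, step_of_gt, ← mul_assoc]
      rw [h.far i (l + 1) (by omega) (by omega) (by omega)]
    rcases eq_or_ne j (l + 1 + 1) with rfl | h₆
    · simp (disch := omega) only [step_succ, step_of_gt]
    · simp (disch := omega) only [step_of_gt, ← mul_assoc]
      rw [h.isBraidSeq.comm i (l + 1) (by omega) (by omega)]
  braid i hi := by
    ext1 ⟨j, g⟩
    simp only [Equiv.Perm.mul_apply]
    rcases Nat.lt_or_ge m j with hmj | hmj
    · simp (disch := omega) only [step_of_gt_top]
    rcases Nat.lt_or_ge j i with h₁ | h₁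
    · obtain ⟨i, rfl⟩ : ∃ i', i = i' + 1 := ⟨i - 1, by omega⟩
      simp (disch := omega) only [step_of_lt, ← mul_assoc]
      rw [h.isBraidSeq.braid i (by omega)]
    rcases eq_or_ne j i with rfl | h₂
    · simp (disch := omega) only [step_self, step_of_lt, step_of_gt, ← mul_assoc]
      rw [mul_assoc (s j), h.mul j hi]
    rcases eq_or_ne j (i + 1) with rfl | h₃
    · simp (disch := omega) only [step_self, step_succ, step_of_lt, step_of_gt, ← mul_assoc]
      rw [h.succ i hi]
    rcases eq_or_ne j (i + 1 + 1) with rfl | h₄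
    · simp (disch := omega) only [step_succ, step_of_lt, step_of_gt]
    · simp (disch := omega) only [step_of_gt, ← mul_assoc]
      rw [h.isBraidSeq.braid i (by omega)]

end Step

section Combing

open SemidirectProduct

variable {m : ℕ}

/-- The action of the braid group on `m + 1` strings on pairs (position of the last strand,
element of the semidirect product). -/
def combAction (m : ℕ) : BraidGroup (m + 1) →* Equiv.Perm (ℕ × ArtinProduct m) :=
  lift (n := m + 1) (isArtinPair_artinProduct m).isBraidSeq_step

theorem combAction_gen {i : ℕ} (hi : i < m) : combAction m (gen (m + 1) i) =
    step (fun i => (inr (gen m i) : ArtinProduct m)) (fun j => inl (FreeGroup.of j)) m i :=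
  lift_gen (n := m + 1) _ hi

/-- The embedding of the semidirect product in the braid group on `m + 1` strings, sending the
free generators to loops of the last strand. -/
def combEmb (m : ℕ) : ArtinProduct m →* BraidGroup (m + 1) :=
  IsArtinPair.lift (isBraidSeq_gen (m + 1)).isArtinPair_loop

theorem combEmb_inl (j : ℕ) :
    combEmb m (inl (FreeGroup.of j)) = loop (gen (m + 1)) m j :=
  IsArtinPair.lift_inl _ j

theorem combEmb_inr {i : ℕ} (hi : i < m - 1) :
    combEmb m (inr (gen m i)) = gen (m + 1) i :=
  IsArtinPair.lift_inr _ hi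

theorem combAction_mul_right (β : BraidGroup (m + 1)) (p : ℕ × ArtinProduct m)
    (h : ArtinProduct m) :
    combAction m β (p.1, p.2 * h) = ((combAction m β p).1, (combAction m β p).2 * h) := by
  induction β using induction_on generalizing p with
  | one => simp
  | gen i hi =>
    obtain ⟨j, g⟩ := p
    rw [combAction_gen (m := m) hi]
    simp only [step, Equiv.coe_fn_mk]
    split_ifs <;> simp [mul_assoc]
  | mul a b ha hb => rw [map_mul, Equiv.Perm.mul_apply, hb, ha, Equiv.Perm.mul_apply]
  | inv a ha =>
    have := ha ((combAction m a)⁻¹ p)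
    rw [← Equiv.Perm.mul_apply, mul_inv_cancel, Equiv.Perm.one_apply] at this
    rw [map_inv, Equiv.Perm.inv_eq_iff_eq]
    exact this.symm

theorem combAction_fst (β : BraidGroup (m + 1)) (p : ℕ × ArtinProduct m) :
    (combAction m β p).1 = perm (m + 1) β p.1 := by
  induction β using induction_on generalizing p with
  | one => simp
  | gen i hi =>
    obtain ⟨j, g⟩ := p
    rw [combAction_gen (m := m) hi, perm_gen hi]
    simp only [step, Equiv.coe_fn_mk, Equiv.swap_apply_def]
    split_ifs <;> simp_all
  | mul a b ha hb => rw [map_mul, Equiv.Perm.mul_apply, ha, hb, map_mul, Equiv.Perm.mul_apply]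
  | inv a ha =>
    rw [map_inv, map_inv, eq_comm, Equiv.Perm.inv_eq_iff_eq, ← ha,
      ← Equiv.Perm.mul_apply, mul_inv_cancel, Equiv.Perm.one_apply]

/-- The braid recorded by a pair (position of the last strand, element of the semidirect
product). -/
def assemble (p : ℕ × ArtinProduct m) : BraidGroup (m + 1) :=
  run (gen (m + 1)) p.1 (m - p.1) * combEmb m p.2

theorem assemble_top (g : ArtinProduct m) : assemble (m, g) = combEmb m g := by
  simp [assemble]

theorem assemble_combAction_gen {i : ℕ} (hi : i < m) {p : ℕ × ArtinProduct m} (hp : p.1 ≤ m) :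
    (combAction m (gen (m + 1) i) p).1 ≤ m ∧
      assemble (combAction m (gen (m + 1) i) p) = gen (m + 1) i * assemble p := by
  obtain ⟨j, g⟩ := p
  have hB := isBraidSeq_gen (m + 1)
  rw [combAction_gen hi]
  simp only at hp
  rcases Nat.lt_or_ge j i with h₁ | h₁
  · obtain ⟨i, rfl⟩ : ∃ i', i = i' + 1 := ⟨i - 1, by omega⟩
    rw [step_of_lt _ (by omega)]
    refine ⟨hp, ?_⟩
    simp only [assemble]
    rw [map_mul, combEmb_inr (by omega), ← mul_assoc, ← mul_assoc,
      hB.succ_mul_run (by omega) (by omega) (by omega)]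
  rcases eq_or_ne j i with rfl | h₂
  · rw [step_self]
    refine ⟨hi, ?_⟩
    simp only [assemble]
    rw [map_mul, combEmb_inl, loop_eq hi, ← mul_run_succ _ hi, pow_two]
    group
  rcases eq_or_ne j (i + 1) with rfl | h₃
  · rw [step_succ]
    refine ⟨hi.le, ?_⟩
    simp only [assemble]
    rw [← mul_assoc, mul_run_succ _ hi]
  · rw [step_of_gt _ (by omega) hp]
    refine ⟨hp, ?_⟩
    simp only [assemble]
    rw [map_mul, combEmb_inr (by omega), ← mul_assoc, ← mul_assoc,
      hB.commute_run_of_lt (by omega) (by simp; omega)]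

theorem le_of_combAction_gen_le {i : ℕ} (hi : i < m) {p : ℕ × ArtinProduct m}
    (hp : (combAction m (gen (m + 1) i) p).1 ≤ m) : p.1 ≤ m := by
  obtain ⟨j, g⟩ := p
  by_contra hj
  rw [combAction_gen hi, step_of_gt_top _ hi (by simpa using hj)] at hp
  exact hj hp

theorem assemble_combAction (β : BraidGroup (m + 1)) (p : ℕ × ArtinProduct m) :
    ((combAction m β p).1 ≤ m ↔ p.1 ≤ m) ∧
      (p.1 ≤ m → assemble (combAction m β p) = β * assemble p) := by
  induction β using induction_on generalizing p with
  | one => simp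
  | gen i hi =>
    exact ⟨⟨le_of_combAction_gen_le hi, fun hp => (assemble_combAction_gen hi hp).1⟩,
      fun hp => (assemble_combAction_gen hi hp).2⟩
  | mul a b ha hb =>
    rw [map_mul, Equiv.Perm.mul_apply]
    refine ⟨(ha _).1.trans (hb _).1, fun hp => ?_⟩
    rw [(ha _).2 ((hb p).1.mpr hp), (hb p).2 hp, mul_assoc]
  | inv a ha =>
    have := ha ((combAction m a)⁻¹ p)
    rw [← Equiv.Perm.mul_apply, mul_inv_cancel, Equiv.Perm.one_apply] at this
    rw [map_inv]
    refine ⟨this.1.symm, fun hp => ?_⟩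
    rw [this.2 (this.1.mp hp), inv_mul_cancel_left]

theorem eq_combEmb_of_combAction {β : BraidGroup (m + 1)} {g : ArtinProduct m}
    (h : combAction m β (m, 1) = (m, g)) : β = combEmb m g := by
  have := (assemble_combAction β (m, 1)).2 le_rfl
  rwa [h, assemble_top, assemble_top, map_one, mul_one, eq_comm] at this

/-- The elements of the semidirect product recovered from their image in the braid group
by its action on pairs. -/
def recoverable (m : ℕ) : Subgroup (ArtinProduct m) where
  carrier := {g | combAction m (combEmb m g) (m, 1) = (m, g)}
  one_mem' := by simp
  mul_mem' := by
    intro a b ha hb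
    simp only [Set.mem_ofPred_eq] at *
    rw [map_mul, map_mul, Equiv.Perm.mul_apply, hb]
    have := combAction_mul_right (combEmb m a) (m, 1) b
    rwa [ha, one_mul] at this
  inv_mem' := by
    intro a ha
    simp only [Set.mem_ofPred_eq] at *
    rw [map_inv, map_inv, Equiv.Perm.inv_eq_iff_eq, eq_comm]
    have := combAction_mul_right (combEmb m a) (m, 1) a⁻¹
    rwa [ha, one_mul, mul_inv_cancel] at this

theorem mem_recoverable_of_combAction {β : BraidGroup (m + 1)} {g : ArtinProduct m}
    (h : combAction m β (m, 1) = (m, g)) : g ∈ recoverable m := by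
  rwa [eq_combEmb_of_combAction h] at h

theorem combEmb_injOn : Set.InjOn (combEmb m) (recoverable m) := by
  intro a ha b hb hab
  have ha' : combAction m (combEmb m a) (m, 1) = (m, a) := ha
  have hb' : combAction m (combEmb m b) (m, 1) = (m, b) := hb
  rw [hab, hb'] at ha'
  exact (congrArg Prod.snd ha').symm

theorem exists_recoverable_of_perm_eq_one {β : BraidGroup (m + 1)}
    (h : perm (m + 1) β = 1) : ∃ g ∈ recoverable m, combEmb m g = β := by
  have h₁ : combAction m β (m, 1) = (m, (combAction m β (m, 1)).2) := by
    ext1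
    · rw [combAction_fst, h, Equiv.Perm.one_apply]
    · rfl
  exact ⟨_, mem_recoverable_of_combAction h₁, (eq_combEmb_of_combAction h₁).symm⟩

theorem inr_mem_recoverable (b : BraidGroup m) : inr b ∈ recoverable m := by
  induction b using induction_on with
  | one => rw [map_one]; exact one_mem _
  | gen i hi =>
    apply mem_recoverable_of_combAction (β := gen (m + 1) i)
    rw [combAction_gen (by omega), step_of_gt _ (by omega) le_rfl, mul_one]
  | mul a b ha hb => rw [map_mul]; exact mul_mem ha hb
  | inv a ha => rw [map_inv]; exact inv_mem ha

theorem combAction_run {j l : ℕ} (h : j + l = m) :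
    combAction m (run (gen (m + 1)) j l) (m, 1) = (j, 1) := by
  induction l generalizing j with
  | zero => simp [← h]
  | succ l ih =>
    rw [run_succ', map_mul, Equiv.Perm.mul_apply, ih (by omega), combAction_gen (by omega),
      step_succ]

theorem inl_of_mem_recoverable {j : ℕ} (hj : j < m) :
    inl (FreeGroup.of j) ∈ recoverable m := by
  apply mem_recoverable_of_combAction (β := loop (gen (m + 1)) m j)
  rw [loop_eq hj, mul_assoc, map_mul, map_inv, Equiv.Perm.mul_apply, Equiv.Perm.inv_eq_iff_eq,
    map_mul, Equiv.Perm.mul_apply, combAction_run (by omega), pow_two, map_mul,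
    Equiv.Perm.mul_apply, combAction_gen hj, step_succ, step_self, mul_one]
  have := combAction_mul_right (run (gen (m + 1)) (j + 1) (m - (j + 1))) (m, 1)
    (inl (FreeGroup.of j))
  rw [combAction_run (by omega), one_mul] at this
  exact this.symm

theorem exists_combAction_revRun {l : ℕ} (hl : l ≤ m) :
    ∃ f : FreeGroup ℕ, combAction m (revRun (gen (m + 1)) l) (0, 1) = (l, inl f) := by
  induction l with
  | zero => exact ⟨1, by simp [revRun]⟩
  | succ l ih =>
    obtain ⟨f, hf⟩ := ih (by omega)
    refine ⟨FreeGroup.of l * f, ?_⟩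
    rw [revRun, map_mul, Equiv.Perm.mul_apply, hf, combAction_gen (by omega), step_self, map_mul]

theorem garside_succ_sq (m : ℕ) : garside (gen (m + 1)) (m + 1) ^ 2 =
    garside (gen (m + 1)) m ^ 2 *
      (revRun (gen (m + 1)) m * run (gen (m + 1)) 0 m) := by
  have hc := Subgroup.mem_center_iff.mp (garside_sq_mem_center (m + 1))
    (run (gen (m + 1)) 0 m)
  have h₁ : garside (gen (m + 1)) (m + 1) =
      run (gen (m + 1)) 0 m * garside (gen (m + 1)) m := rfl
  have h₂ := (isBraidSeq_gen (m + 1)).garside_succ' (m := m) (by omega)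
  apply mul_left_cancel (a := run (gen (m + 1)) 0 m)
  rw [hc]
  nth_rewrite 1 [pow_two]
  nth_rewrite 1 [h₁]
  rw [h₂, pow_two]
  simp only [mul_assoc]

theorem exists_recoverable_garside_sq (m : ℕ) : ∃ z ∈ recoverable m,
    combEmb m z = garside (gen (m + 1)) (m + 1) ^ 2 ∧ z.right = garside (gen m) m ^ 2 := by
  obtain ⟨f, hf⟩ := exists_combAction_revRun (m := m) le_rfl
  have hw : combAction m (revRun (gen (m + 1)) m * run (gen (m + 1)) 0 m) (m, 1) =
      (m, inl f) := by
    rw [map_mul, Equiv.Perm.mul_apply, combAction_run (by omega), hf]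
  refine ⟨inr (garside (gen m) m ^ 2) * inl f,
    mul_mem (inr_mem_recoverable _) (mem_recoverable_of_combAction hw), ?_, by
    rw [mul_right, right_inr, right_inl, mul_one]⟩
  rw [map_mul, ← eq_combEmb_of_combAction hw, garside_succ_sq, map_pow, map_pow]
  congr 2
  exact map_garside ((combEmb m).comp inr) m fun i hi => combEmb_inr hi

theorem perm_combEmb (g : ArtinProduct m) : perm (m + 1) (combEmb m g) = perm m g.right := by
  have : (perm (m + 1)).comp (combEmb m) = (perm m).comp rightHom := by
    apply SemidirectProduct.hom_ext
    · ext1 j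
      simp only [MonoidHom.comp_apply, combEmb_inl, rightHom_inl, map_one]
      rw [loop]
      split_ifs with hj
      · simp [perm_gen (show j < m + 1 - 1 from hj), pow_two, mul_assoc]
      · exact map_one _
    · apply hom_ext
      intro i hi
      simp only [MonoidHom.comp_apply, combEmb_inr hi, rightHom_inr]
      rw [perm_gen (by omega), perm_gen hi]
  exact DFunLike.congr_fun this g

end Combing

section Main

open SemidirectProduct

theorem exists_eq_zpow_of_perm_eq_one_two {β : BraidGroup 2} (h : perm 2 β = 1) :
    ∃ d : ℤ, β = (garside (gen 2) 2 ^ 2) ^ d := by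
  have hg : garside (gen 2) 2 = gen 2 0 := by simp [garside, run]
  have hβ : ∃ a : ℤ, β = gen 2 0 ^ a := by
    clear h
    induction β using induction_on with
    | one => exact ⟨0, by simp⟩
    | gen i hi => exact ⟨1, by rw [zpow_one]; congr 1; omega⟩
    | mul x y hx hy =>
      obtain ⟨⟨a, rfl⟩, b, rfl⟩ := And.intro hx hy
      exact ⟨a + b, (zpow_add _ _ _).symm⟩
    | inv x hx =>
      obtain ⟨a, rfl⟩ := hx
      exact ⟨-a, (zpow_neg _ _).symm⟩
  obtain ⟨a, rfl⟩ := hβ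
  rcases Int.even_or_odd' a with ⟨d, rfl | rfl⟩
  · exact ⟨d, by rw [hg, zpow_mul]; rfl⟩
  · exfalso
    rw [map_zpow, perm_gen (by omega), zpow_add, zpow_mul] at h
    have hs : (Equiv.swap 0 (0 + 1) : Equiv.Perm ℕ) ^ (2 : ℤ) = 1 := by
      rw [zpow_two, Equiv.swap_mul_self]
    rw [hs, one_zpow, one_mul, zpow_one] at h
    have := DFunLike.congr_fun h 0
    simp at this

/-- A pure braid with a central positive power is a power of the full twist. -/
theorem exists_eq_zpow_of_pow_mem_center {n : ℕ} (hn : 2 ≤ n) {β : BraidGroup n}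
    (hβ : perm n β = 1) {k : ℕ} (hk : k ≠ 0) (hc : β ^ k ∈ Subgroup.center (BraidGroup n)) :
    ∃ d : ℤ, β = (garside (gen n) n ^ 2) ^ d := by
  induction n, hn using Nat.le_induction with
  | base => exact exists_eq_zpow_of_perm_eq_one_two hβ
  | succ m hm ih =>
    have central : ∀ g ∈ recoverable m,
        combEmb m g ∈ Subgroup.center (BraidGroup (m + 1)) → ∀ h ∈ recoverable m,
        Commute g h := by
      intro g hg hgc h hh
      apply combEmb_injOn (mul_mem hg hh) (mul_mem hh hg)
      rw [map_mul, map_mul, Subgroup.mem_center_iff.mp hgc]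
    obtain ⟨g, hg, rfl⟩ := exists_recoverable_of_perm_eq_one hβ
    rw [← map_pow] at hc
    have hgk := central _ (pow_mem hg k) hc
    obtain ⟨d, hd⟩ := ih (β := g.right) (by rw [← perm_combEmb, hβ]) (by
      rw [Subgroup.mem_center_iff]
      intro b
      have := congrArg rightHom (hgk _ (inr_mem_recoverable b)).eq
      rw [map_mul, map_mul, map_pow, rightHom_inr] at this
      exact this.symm)
    obtain ⟨z, hz, hzΔ, hzr⟩ := exists_recoverable_garside_sq m
    have hzc : ∀ h ∈ recoverable m, Commute z h :=
      central z hz (hzΔ ▸ garside_sq_mem_center (m + 1))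
    obtain ⟨f, hf⟩ : ∃ f : FreeGroup ℕ, g * (z ^ d)⁻¹ = inl f := by
      refine ⟨(g * (z ^ d)⁻¹).left, ?_⟩
      ext1
      · rfl
      · change rightHom (g * (z ^ d)⁻¹) = _
        rw [map_mul, map_inv, map_zpow, right_inl, mul_inv_eq_one]
        exact hd.trans (congrArg (· ^ d) hzr.symm)
    have hfk : ∀ j, j < m → Commute (f ^ k) (FreeGroup.of j) := by
      intro j hj
      have hj' := inl_of_mem_recoverable hj
      apply inl_injective (φ := artin m)
      have h₁ : Commute ((g * (z ^ d)⁻¹) ^ k) (inl (FreeGroup.of j)) := by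
        rw [(((hzc g hg).zpow_left d).symm.inv_right).mul_pow]
        exact (hgk _ hj').mul_left ((((hzc _ hj').zpow_left d).inv_left).pow_left k)
      rw [hf, ← map_pow] at h₁
      simpa only [map_mul] using h₁.eq
    have hf1 : f = 1 := by
      have := FreeGroup.eq_one_of_commute_of (by omega) (hfk 0 (by omega)) (hfk 1 (by omega))
      exact (pow_eq_one_iff_left hk).mp this
    rw [hf1, map_one, mul_inv_eq_one] at hf
    exact ⟨d, by rw [hf, map_zpow, hzΔ]⟩

end Main

end BraidGroup

/-- For `n ≥ 2` and a pure braid `β ∈ P_n`, `β` is periodic (some positive power of `β`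
is central in `B_n`) if and only if `β` is a power of the full twist `Δ²`. -/
theorem pure_braid_periodic_iff_power_of_full_twist (n : ℕ) (hn : 2 ≤ n)
    (μ : BraidGroup n →* Equiv.Perm (Fin n))
    (hμ : ∀ i : Fin (n - 1), μ (σ i) =
      Equiv.swap ⟨(i : ℕ), by have := i.isLt; omega⟩ ⟨(i : ℕ) + 1, by have := i.isLt; omega⟩)
    (β : BraidGroup n) (hβ : β ∈ μ.ker) :
    (∃ k : ℕ, 1 ≤ k ∧ β ^ k ∈ Subgroup.center (BraidGroup n)) ↔
    (∃ d : ℤ, β = halfTwist n ^ (2 * d)) := by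
  rw [BraidGroup.halfTwist_eq_garside]
  have hzpow : ∀ d : ℤ, BraidGroup.garside (BraidGroup.gen n) n ^ (2 * d) =
      (BraidGroup.garside (BraidGroup.gen n) n ^ 2) ^ d := fun d => by
    rw [zpow_mul]
    rfl
  simp only [hzpow]
  constructor
  · rintro ⟨k, hk, hc⟩
    exact BraidGroup.exists_eq_zpow_of_pow_mem_center hn
      (BraidGroup.perm_eq_one_of_mem_ker μ hμ hβ) (by omega) hc
  · rintro ⟨d, rfl⟩
    exact ⟨1, le_rfl, pow_mem (zpow_mem (BraidGroup.garside_sq_mem_center n) d) 1⟩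
end
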